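/- arXiv:math/0011234 — 3 statements merged into one kernel-verified Lean document; each statement's English description precedes it below -/
import Mathlib

section
/- For every finite graph Γ, the map sending a Morse matching M on Γ to the set of edges e of Γ that are matched in M with one of their endpoints v, with each such edge oriented away from its matched endpoint v, is a bijection between the set of Morse matchings on Γ and the set of rooted forests of Γ. -/
/-!
STATEMENT 0: The map sending a Morse matching `M` on a finite graph `Γ` to the set of
its matched edges, each oriented away from its matched endpoint, is a bijection between
the Morse matchings on `Γ` and the rooted forests of `Γ`.
-/

open Finset

/-- Arc of the Hasse diagram of the simplicial complex `K`: from `g` to `f` whenever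
`f ⊂ g` and `dim g = dim f + 1`. -/
def HasseArc {V : Type} [DecidableEq V] (K : Finset (Finset V)) (g f : Finset V) : Prop :=
  g ∈ K ∧ f ∈ K ∧ f ⊂ g ∧ g.card = f.card + 1

/-- `M` is a matching: no two distinct pairs of `M` share an endpoint. -/
def IsMatchingPairs {α : Type} (M : Set (α × α)) : Prop :=
  ∀ p ∈ M, ∀ q ∈ M, p ≠ q → p.1 ≠ q.1 ∧ p.1 ≠ q.2 ∧ p.2 ≠ q.1 ∧ p.2 ≠ q.2

/-- One step of the Hasse diagram of `K` with the arcs belonging to `M` reversed. -/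
def MorseStep {V : Type} [DecidableEq V] (K : Finset (Finset V))
    (M : Set (Finset V × Finset V)) (x y : Finset V) : Prop :=
  (HasseArc K x y ∧ (x, y) ∉ M) ∨ ((y, x) ∈ M ∧ HasseArc K y x)

/-- A (discrete) Morse matching on the complex `K`: a matching in the Hasse diagram of `K`
such that reversing exactly the arcs of the matching yields a directed graph with no
directed cycle. -/
def IsMorseMatching {V : Type} [DecidableEq V] (K : Finset (Finset V))
    (M : Set (Finset V × Finset V)) : Prop :=
  (∀ p ∈ M, HasseArc K p.1 p.2) ∧ IsMatchingPairs M ∧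
    ∀ s : Finset V, ¬ Relation.TransGen (MorseStep K M) s s

/-- A finite graph regarded as a one-dimensional simplicial complex: faces are the
vertices (as singletons) and the edges (as two-element sets). -/
noncomputable def graphComplex {V : Type} [Fintype V] [DecidableEq V] (G : SimpleGraph V) :
    Finset (Finset V) := by
  classical
  exact Finset.univ.filter fun s => (∃ v, s = {v}) ∨ ∃ u v, G.Adj u v ∧ s = {u, v}

/-- A rooted forest of a graph `G`: a set of oriented edges of `G` (the ordered pair `(v, w)`
is the edge `{v, w}` oriented away from `v`), each edge with a single orientation,
with out-degree at most one at each node and containing no cycle as undirected graph. -/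
def IsRootedForest {V : Type} (G : SimpleGraph V) (F : Set (V × V)) : Prop :=
  (∀ p ∈ F, G.Adj p.1 p.2) ∧
  (∀ p ∈ F, (p.2, p.1) ∉ F) ∧
  (∀ v w w', (v, w) ∈ F → (v, w') ∈ F → w = w') ∧
  (SimpleGraph.fromEdgeSet {e | ∃ p ∈ F, e = s(p.1, p.2)}).IsAcyclic

/-- The set of oriented edges associated to a Morse matching on a graph: the pair `(v, w)`
records that the edge `{v, w}` is matched with its endpoint `v` (and oriented away from `v`). -/
def forestOf {V : Type} [DecidableEq V] (M : Set (Finset V × Finset V)) : Set (V × V) :=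
  {p | (({p.1, p.2} : Finset V), ({p.1} : Finset V)) ∈ M}

section PairFinset

variable {V : Type} [DecidableEq V]

lemma pair_right_injective {v w w' : V} (h : ({v, w} : Finset V) = {v, w'}) : w = w' := by
  have h1 : w ∈ ({v, w'} : Finset V) := h ▸ by simp
  have h2 : w' ∈ ({v, w} : Finset V) := h ▸ by simp
  simp only [Finset.mem_insert, Finset.mem_singleton] at h1 h2
  grind

lemma singleton_ne_pair {x v w : V} (h : v ≠ w) : ({x} : Finset V) ≠ {v, w} := fun he => by
  simpa [Finset.card_pair h] using congrArg Finset.card he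

/-- The Hasse arcs of a graph are exactly those from an edge to one of its endpoints. -/
lemma hasseArc_graphComplex_iff [Fintype V] (G : SimpleGraph V) (g f : Finset V) :
    HasseArc (graphComplex G) g f ↔ ∃ v w, G.Adj v w ∧ g = {v, w} ∧ f = {v} := by
  constructor
  · rintro ⟨hg, hf, hss, hcard⟩
    simp only [graphComplex, Finset.mem_filter, Finset.mem_univ, true_and] at hg hf
    have hpos : f.card ≠ 0 := by
      rcases hf with ⟨v, rfl⟩ | ⟨u, v, -, rfl⟩ <;> simp
    rcases hg with ⟨v, rfl⟩ | ⟨u, v, huv, rfl⟩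
    · rw [Finset.card_singleton] at hcard
      omega
    · rw [Finset.card_pair huv.ne] at hcard
      obtain ⟨x, rfl⟩ := Finset.card_eq_one.mp (show f.card = 1 by omega)
      have hx : x ∈ ({u, v} : Finset V) := hss.subset (by simp)
      rw [Finset.mem_insert, Finset.mem_singleton] at hx
      rcases hx with rfl | rfl
      · exact ⟨x, v, huv, rfl, rfl⟩
      · exact ⟨x, u, huv.symm, Finset.pair_comm _ _, rfl⟩
  · rintro ⟨v, w, h, rfl, rfl⟩
    refine ⟨?_, ?_, ?_, ?_⟩
    · simp only [graphComplex, Finset.mem_filter, Finset.mem_univ, true_and]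
      exact Or.inr ⟨v, w, h, rfl⟩
    · simp [graphComplex]
    · refine Finset.ssubset_iff_subset_ne.mpr ⟨by simp, singleton_ne_pair h.ne⟩
    · simp [Finset.card_pair h.ne]

end PairFinset

section OrientedEdges

variable {V : Type} {F : Set (V × V)}

/-- The undirected graph underlying a set of oriented edges. -/
abbrev underlyingGraph (F : Set (V × V)) : SimpleGraph V :=
  SimpleGraph.fromEdgeSet {e | ∃ p ∈ F, e = s(p.1, p.2)}

lemma underlyingGraph_adj {x y : V} :
    (underlyingGraph F).Adj x y ↔ ((x, y) ∈ F ∨ (y, x) ∈ F) ∧ x ≠ y := by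
  simp only [SimpleGraph.fromEdgeSet_adj, Set.mem_ofPred_eq, Prod.exists, Sym2.eq_iff]
  grind

/-- An antisymmetric set of oriented edges whose underlying graph is acyclic has no directed
cycle. -/
lemma not_transGen_of_isAcyclic (hanti : ∀ p ∈ F, (p.2, p.1) ∉ F)
    (hac : (underlyingGraph F).IsAcyclic) (v : V) :
    ¬ Relation.TransGen (fun x y => (x, y) ∈ F) v v := by
  intro hcyc
  have hne : ∀ {x y}, (x, y) ∈ F → x ≠ y := by
    rintro x _ h rfl
    exact hanti _ h h
  obtain ⟨w, hvw, hwv⟩ := Relation.TransGen.head'_iff.mp hcyc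
  have hbridge := SimpleGraph.isAcyclic_iff_forall_adj_isBridge.mp hac
    (underlyingGraph_adj.mpr ⟨Or.inl hvw, hne hvw⟩)
  rw [SimpleGraph.isBridge_iff] at hbridge
  suffices hreach : ∀ x, Relation.ReflTransGen (fun x y => (x, y) ∈ F) x v →
      ((underlyingGraph F).deleteEdges {s(v, w)}).Reachable x v from
    hbridge (hreach w hwv).symm
  intro x hx
  induction hx using Relation.ReflTransGen.head_induction_on with
  | refl => exact .rfl
  | @head x y hxy _ ih =>
    by_cases hxv : x = v
    · exact hxv ▸ .rfl
    · refine .trans (SimpleGraph.Adj.reachable ?_) ih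
      rw [SimpleGraph.deleteEdges_adj, underlyingGraph_adj]
      refine ⟨⟨Or.inl hxy, hne hxy⟩, fun he => ?_⟩
      obtain ⟨rfl, -⟩ | ⟨rfl, rfl⟩ := Sym2.eq_iff.mp (Set.mem_singleton_iff.mp he)
      · exact hxv rfl
      · exact hanti _ hvw hxy

/-- A set of oriented edges of out-degree at most one without directed cycle has an acyclic
underlying graph. -/
lemma isAcyclic_of_not_transGen (hfun : ∀ v w w', (v, w) ∈ F → (v, w') ∈ F → w = w')
    (hcyc : ∀ v, ¬ Relation.TransGen (fun x y => (x, y) ∈ F) v v) :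
    (underlyingGraph F).IsAcyclic := by
  have hbridge : ∀ v w, (v, w) ∈ F → (underlyingGraph F).IsBridge s(v, w) := by
    intro v w hvw
    rw [SimpleGraph.isBridge_iff]
    rintro ⟨p⟩
    have hclosed : ∀ {x y}, ((underlyingGraph F).deleteEdges {s(v, w)}).Walk x y →
        Relation.ReflTransGen (fun x y => (x, y) ∈ F) x v →
        Relation.ReflTransGen (fun x y => (x, y) ∈ F) y v := by
      intro x y p
      induction p with
      | nil => exact id
      | @cons x z y hxz _ ih =>
        intro hx
        refine ih ?_
        rw [SimpleGraph.deleteEdges_adj, underlyingGraph_adj] at hxz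
        obtain ⟨⟨hF | hF, -⟩, hne⟩ := hxz
        · rcases Relation.ReflTransGen.cases_head hx with rfl | ⟨z', hz', hz'v⟩
          · exact absurd (by rw [hfun _ _ _ hF hvw]; rfl) hne
          · rwa [hfun _ _ _ hF hz']
        · exact .head hF hx
    exact hcyc v (.head' hvw (hclosed p .refl))
  rw [SimpleGraph.isAcyclic_iff_forall_adj_isBridge]
  intro x y hxy
  rcases (underlyingGraph_adj.mp hxy).1 with h | h
  · exact hbridge x y h
  · rw [Sym2.eq_swap]
    exact hbridge y x h

end OrientedEdges

section MorseMatchings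

variable {V : Type} [Fintype V] [DecidableEq V] {G : SimpleGraph V}
  {M : Set (Finset V × Finset V)}

lemma mem_iff_exists_forestOf (harc : ∀ p ∈ M, HasseArc (graphComplex G) p.1 p.2)
    (p : Finset V × Finset V) :
    p ∈ M ↔ ∃ v w, (v, w) ∈ forestOf M ∧ p = ({v, w}, {v}) := by
  constructor
  · intro hp
    obtain ⟨v, w, -, h1, h2⟩ := (hasseArc_graphComplex_iff G _ _).mp (harc p hp)
    obtain rfl : p = ({v, w}, {v}) := Prod.ext h1 h2
    exact ⟨v, w, hp, rfl⟩
  · rintro ⟨v, w, h, rfl⟩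
    exact h

lemma adj_of_mem_forestOf (harc : ∀ p ∈ M, HasseArc (graphComplex G) p.1 p.2) {v w : V}
    (h : (v, w) ∈ forestOf M) : G.Adj v w := by
  obtain ⟨a, b, hab, h1, h2⟩ := (hasseArc_graphComplex_iff G _ _).mp (harc _ h)
  obtain rfl : v = a := Finset.singleton_injective h2
  obtain rfl : w = b := pair_right_injective h1
  exact hab

/-- A matching in the Hasse diagram of a graph amounts to a set of edges, each with a single
orientation, of out-degree at most one. -/
lemma isMatchingPairs_iff_forestOf (harc : ∀ p ∈ M, HasseArc (graphComplex G) p.1 p.2) :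
    IsMatchingPairs M ↔ (∀ p ∈ forestOf M, (p.2, p.1) ∉ forestOf M) ∧
      ∀ v w w', (v, w) ∈ forestOf M → (v, w') ∈ forestOf M → w = w' := by
  constructor
  · refine fun hM => ⟨?_, ?_⟩
    · rintro ⟨v, w⟩ h h'
      refine (hM _ h _ h' fun he => ?_).1 (Finset.pair_comm _ _)
      exact (adj_of_mem_forestOf harc h).ne (Finset.singleton_injective (congrArg Prod.snd he))
    · intro v w w' h h'
      by_contra hne
      exact (hM _ h _ h' fun he => hne (pair_right_injective (congrArg Prod.fst he))).2.2.2 rfl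
  · rintro ⟨hanti, hfun⟩ p hp q hq hpq
    obtain ⟨v, w, hvw, rfl⟩ := (mem_iff_exists_forestOf harc p).mp hp
    obtain ⟨a, b, hab, rfl⟩ := (mem_iff_exists_forestOf harc q).mp hq
    have hva : v ≠ a := by
      rintro rfl
      exact hpq (by rw [hfun _ _ _ hvw hab])
    refine ⟨fun he => ?_, (singleton_ne_pair (adj_of_mem_forestOf harc hvw).ne).symm,
      singleton_ne_pair (adj_of_mem_forestOf harc hab).ne,
      fun he => hva (Finset.singleton_injective he)⟩
    dsimp only at he
    have hv : v ∈ ({a, b} : Finset V) := he ▸ by simp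
    obtain rfl : v = b := by simpa [hva] using hv
    rw [Finset.pair_comm a] at he
    obtain rfl := pair_right_injective he
    exact hanti _ hvw hab

lemma morseStep_of_mem_forestOf (harc : ∀ p ∈ M, HasseArc (graphComplex G) p.1 p.2)
    {v w : V} (h : (v, w) ∈ forestOf M) : MorseStep (graphComplex G) M {v} {v, w} :=
  Or.inr ⟨h, harc _ h⟩

lemma exists_of_morseStep_singleton {v : V} {t : Finset V}
    (h : MorseStep (graphComplex G) M {v} t) : ∃ w, (v, w) ∈ forestOf M ∧ t = {v, w} := by
  rcases h with ⟨h, -⟩ | ⟨hM, h⟩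
  · obtain ⟨a, b, hab, h1, -⟩ := (hasseArc_graphComplex_iff G _ _).mp h
    exact absurd h1 (singleton_ne_pair hab.ne)
  · obtain ⟨a, b, -, rfl, h2⟩ := (hasseArc_graphComplex_iff G _ _).mp h
    obtain rfl := Finset.singleton_injective h2
    exact ⟨b, hM, rfl⟩

lemma eq_of_morseStep_pair {v w : V} {t : Finset V} (hF : (v, w) ∈ forestOf M)
    (hvw : v ≠ w) (h : MorseStep (graphComplex G) M {v, w} t) : t = {w} := by
  rcases h with ⟨h, hM⟩ | ⟨-, h⟩
  · obtain ⟨a, b, -, h1, rfl⟩ := (hasseArc_graphComplex_iff G _ _).mp h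
    have ha : a ∈ ({v, w} : Finset V) := h1 ▸ by simp
    rw [Finset.mem_insert, Finset.mem_singleton] at ha
    rcases ha with rfl | rfl
    · exact absurd hF hM
    · rfl
  · obtain ⟨a, b, -, -, h2⟩ := (hasseArc_graphComplex_iff G _ _).mp h
    exact absurd h2.symm (singleton_ne_pair hvw)

lemma exists_singleton_of_morseStep {s t : Finset V} (h : MorseStep (graphComplex G) M s t) :
    ∃ v, s = {v} ∨ t = {v} := by
  rcases h with ⟨h, -⟩ | ⟨-, h⟩ <;>
    obtain ⟨a, b, -, -, h2⟩ := (hasseArc_graphComplex_iff G _ _).mp h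
  · exact ⟨a, Or.inr h2⟩
  · exact ⟨a, Or.inl h2⟩

/-- The directed paths from a node in the modified Hasse diagram follow the oriented edges
of `forestOf M`. -/
lemma transGen_forestOf_of_transGen_morseStep
    (harc : ∀ p ∈ M, HasseArc (graphComplex G) p.1 p.2) {v : V} {t : Finset V}
    (h : Relation.TransGen (MorseStep (graphComplex G) M) {v} t) :
    (∃ x, t = {x} ∧ Relation.TransGen (fun x y => (x, y) ∈ forestOf M) v x) ∨
      ∃ x y, t = {x, y} ∧ (x, y) ∈ forestOf M ∧
        Relation.ReflTransGen (fun x y => (x, y) ∈ forestOf M) v x := by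
  induction h with
  | single h =>
    obtain ⟨w, hw, rfl⟩ := exists_of_morseStep_singleton h
    exact Or.inr ⟨v, w, rfl, hw, .refl⟩
  | tail _ h ih =>
    rcases ih with ⟨x, rfl, hx⟩ | ⟨x, y, rfl, hxy, hx⟩
    · obtain ⟨w, hw, rfl⟩ := exists_of_morseStep_singleton h
      exact Or.inr ⟨x, w, rfl, hw, hx.to_reflTransGen⟩
    · exact Or.inl ⟨y, eq_of_morseStep_pair hxy (adj_of_mem_forestOf harc hxy).ne h,
        .tail' hx hxy⟩

/-- For matchings in the Hasse diagram of a graph, directed cycles in the modified Hasse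
diagram correspond to directed cycles of `forestOf M`. -/
lemma not_transGen_morseStep_iff (harc : ∀ p ∈ M, HasseArc (graphComplex G) p.1 p.2)
    (hanti : ∀ p ∈ forestOf M, (p.2, p.1) ∉ forestOf M) :
    (∀ s, ¬ Relation.TransGen (MorseStep (graphComplex G) M) s s) ↔
      ∀ v, ¬ Relation.TransGen (fun x y => (x, y) ∈ forestOf M) v v := by
  constructor
  · intro h v hv
    refine h {v} (Relation.TransGen.lift' (f := fun x : V => ({x} : Finset V)) ?_ _ _ hv)
    intro x y hxy
    refine .head (morseStep_of_mem_forestOf harc hxy) (.single (Or.inl ⟨?_, fun hM => ?_⟩))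
    · exact (hasseArc_graphComplex_iff G _ _).mpr
        ⟨y, x, (adj_of_mem_forestOf harc hxy).symm, Finset.pair_comm _ _, rfl⟩
    · rw [Finset.pair_comm] at hM
      exact hanti _ hxy hM
  · intro h
    have hnode : ∀ v : V, ¬ Relation.TransGen (MorseStep (graphComplex G) M) {v} {v} := by
      intro v hv
      rcases transGen_forestOf_of_transGen_morseStep harc hv with ⟨x, hx, hvx⟩ | ⟨x, y, hx, hxy, -⟩
      · obtain rfl := Finset.singleton_injective hx
        exact h _ hvx
      · exact singleton_ne_pair (adj_of_mem_forestOf harc hxy).ne hx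
    intro s hs
    obtain ⟨t, hst, hts⟩ := Relation.TransGen.head'_iff.mp hs
    obtain ⟨v, rfl | rfl⟩ := exists_singleton_of_morseStep hst
    · exact hnode v hs
    · exact hnode v (.tail' hts hst)

lemma isMorseMatching_iff_isRootedForest
    (harc : ∀ p ∈ M, HasseArc (graphComplex G) p.1 p.2) :
    IsMorseMatching (graphComplex G) M ↔ IsRootedForest G (forestOf M) := by
  constructor
  · rintro ⟨-, hM, hcyc⟩
    obtain ⟨hanti, hfun⟩ := (isMatchingPairs_iff_forestOf harc).mp hM
    exact ⟨fun p hp => adj_of_mem_forestOf harc hp, hanti, hfun,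
      isAcyclic_of_not_transGen hfun ((not_transGen_morseStep_iff harc hanti).mp hcyc)⟩
  · rintro ⟨-, hanti, hfun, hac⟩
    exact ⟨harc, (isMatchingPairs_iff_forestOf harc).mpr ⟨hanti, hfun⟩,
      (not_transGen_morseStep_iff harc hanti).mpr (not_transGen_of_isAcyclic hanti hac)⟩

end MorseMatchings

theorem morse_matchings_biject_with_rooted_forests
    {V : Type} [Fintype V] [DecidableEq V] (G : SimpleGraph V) :
    Set.BijOn forestOf
      {M : Set (Finset V × Finset V) | IsMorseMatching (graphComplex G) M}
      {F : Set (V × V) | IsRootedForest G F} := by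
  refine ⟨fun M hM => (isMorseMatching_iff_isRootedForest hM.1).mp hM, ?_, ?_⟩
  · intro M hM N hN h
    ext p
    rw [mem_iff_exists_forestOf hM.1, mem_iff_exists_forestOf hN.1, h]
  · intro F hF
    let M : Set (Finset V × Finset V) := {q | ∃ p ∈ F, q = ({p.1, p.2}, {p.1})}
    have hMF : forestOf M = F := by
      ext ⟨v, w⟩
      constructor
      · rintro ⟨⟨a, b⟩, hab, he⟩
        obtain ⟨h1, h2⟩ := Prod.mk.inj he
        obtain rfl : v = a := Finset.singleton_injective h2
        obtain rfl : w = b := pair_right_injective h1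
        exact hab
      · exact fun h => ⟨(v, w), h, rfl⟩
    have harc : ∀ q ∈ M, HasseArc (graphComplex G) q.1 q.2 := by
      rintro _ ⟨p, hp, rfl⟩
      exact (hasseArc_graphComplex_iff G _ _).mpr ⟨p.1, p.2, hF.1 p hp, rfl, rfl⟩
    exact ⟨M, (isMorseMatching_iff_isRootedForest harc).mpr (hMF.symm ▸ hF), hMF⟩
end

section
/- For the complete graph K_n on n nodes and every i with 1 ≤ i ≤ n, the number of Morse matchings on K_n of cardinality i (equivalently, the number of rooted forests of K_n with exactly i edges) equals C(n,i)·(n−i)·n^{i−1}. -/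
open Finset

section RootedForest

variable {V : Type}

/-- A rooted forest, given as its set of oriented edges `(child, parent)`: every node has at most
one parent and there is no directed cycle. -/
structure IsRootedForest_s1 (F : Finset (V × V)) : Prop where
  functional : ∀ ⦃a b c⦄, (a, b) ∈ F → (a, c) ∈ F → b = c
  acyclic : ∀ a, ¬ Relation.TransGen (fun x y => (x, y) ∈ F) a a

namespace IsRootedForest_s1

theorem mono {F F' : Finset (V × V)} (h : IsRootedForest_s1 F') (hF : F ⊆ F') : IsRootedForest_s1 F where
  functional _ _ _ hb hc := h.functional (hF hb) (hF hc)
  acyclic a ha := h.acyclic a (Relation.TransGen.mono (fun _ _ hxy => hF hxy) a a ha)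

theorem ne {F : Finset (V × V)} (h : IsRootedForest_s1 F) {a b : V} (hab : (a, b) ∈ F) : a ≠ b := by
  rintro rfl
  exact h.acyclic a (.single hab)

theorem swap_notMem {F : Finset (V × V)} (h : IsRootedForest_s1 F) {a b : V} (hab : (a, b) ∈ F) :
    (b, a) ∉ F :=
  fun hba => h.acyclic a (.head hab (.single hba))

theorem existsUnique_root [Finite V] {F : Finset (V × V)} (h : IsRootedForest_s1 F) (v : V) :
    ∃! r, (∀ w, (r, w) ∉ F) ∧ Relation.ReflTransGen (fun x y => (x, y) ∈ F) v r := by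
  have hwf : WellFounded (Relation.TransGen fun x y => (y, x) ∈ F) := by
    have : Std.Irrefl (Relation.TransGen fun x y : V => (y, x) ∈ F) :=
      ⟨fun a ha => h.acyclic a (Relation.transGen_swap.1 ha)⟩
    exact Finite.wellFounded_of_trans_of_irrefl _
  refine existsUnique_of_exists_of_unique ?_ ?_
  · induction v using hwf.induction with
    | _ v ih =>
      by_cases hv : ∃ w, (v, w) ∈ F
      · obtain ⟨w, hw⟩ := hv
        obtain ⟨r, hr, hwr⟩ := ih w (.single hw)
        exact ⟨r, hr, hwr.head hw⟩
      · exact ⟨v, not_exists.1 hv, .refl⟩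
  · rintro r s ⟨hr, hvr⟩ ⟨hs, hvs⟩
    have hu : Relator.RightUnique fun x y => (x, y) ∈ F := fun _ _ _ hb hc => h.functional hb hc
    rcases Relation.ReflTransGen.total_of_right_unique hu hvr hvs with hrs | hsr
    · rcases hrs.cases_head with rfl | ⟨c, hc, -⟩
      · rfl
      · exact absurd hc (hr c)
    · rcases hsr.cases_head with rfl | ⟨c, hc, -⟩
      · rfl
      · exact absurd hc (hs c)

variable [DecidableEq V]

theorem insert_edge {F : Finset (V × V)} (h : IsRootedForest_s1 F) {r v : V} (hr : ∀ w, (r, w) ∉ F)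
    (hv : ¬ Relation.ReflTransGen (fun x y => (x, y) ∈ F) v r) :
    IsRootedForest_s1 (insert (r, v) F) where
  functional a b c hb hc := by
    rw [mem_insert, Prod.mk.injEq] at hb hc
    rcases hb with ⟨rfl, rfl⟩ | hb <;> rcases hc with ⟨hc, rfl⟩ | hc
    · rfl
    · exact absurd hc (hr c)
    · exact absurd (hc ▸ hb) (hr b)
    · exact h.functional hb hc
  acyclic a ha := by
    have key : ∀ b, Relation.TransGen (fun x y => (x, y) ∈ insert (r, v) F) a b →
        Relation.TransGen (fun x y => (x, y) ∈ F) a b ∨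
          (Relation.ReflTransGen (fun x y => (x, y) ∈ F) a r ∧
            Relation.ReflTransGen (fun x y => (x, y) ∈ F) v b) := by
      intro b hb
      induction hb with
      | single hb =>
        rw [mem_insert, Prod.mk.injEq] at hb
        rcases hb with ⟨rfl, rfl⟩ | hb
        · exact Or.inr ⟨.refl, .refl⟩
        · exact Or.inl (.single hb)
      | tail _ hbc ih =>
        rw [mem_insert, Prod.mk.injEq] at hbc
        rcases hbc with ⟨rfl, rfl⟩ | hbc
        · rcases ih with ih | ih
          · exact Or.inr ⟨ih.to_reflTransGen, .refl⟩
          · exact absurd ih.2 hv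
        · rcases ih with ih | ih
          · exact Or.inl (ih.tail hbc)
          · exact Or.inr ⟨ih.1, ih.2.tail hbc⟩
    rcases key a ha with h' | h'
    · exact h.acyclic a h'
    · exact hv (h'.2.trans h'.1)

theorem insert_edge_iff {F : Finset (V × V)} (h : IsRootedForest_s1 F) {r v : V} :
    (r, v) ∉ F ∧ IsRootedForest_s1 (insert (r, v) F) ↔
      (∀ w, (r, w) ∉ F) ∧ ¬ Relation.ReflTransGen (fun x y => (x, y) ∈ F) v r := by
  refine ⟨fun ⟨hrv, h'⟩ => ⟨fun w hw => ?_, fun hv => ?_⟩,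
    fun ⟨hr, hv⟩ => ⟨hr v, h.insert_edge hr hv⟩⟩
  · exact hrv (h'.functional (mem_insert_of_mem hw) (mem_insert_self _ _) ▸ hw)
  · refine h'.acyclic r (.head' (mem_insert_self _ _) ?_)
    exact Relation.ReflTransGen.mono (fun _ _ hxy => mem_insert_of_mem hxy) v r hv

open Classical in
theorem card_roots_add_card [Fintype V] {F : Finset (V × V)} (h : IsRootedForest_s1 F) :
    #{r : V | ∀ w, (r, w) ∉ F} + #F = Fintype.card V := by
  have himage : F.image Prod.fst = ({r : V | ∀ w, (r, w) ∉ F} : Finset V)ᶜ := by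
    ext r
    simp
  have hinj : #(F.image Prod.fst) = #F := by
    refine card_image_of_injOn ?_
    rintro ⟨a, b⟩ hb ⟨a', c⟩ hc (rfl : a = a')
    rw [h.functional hb hc]
  rw [← hinj, himage, card_add_card_compl]

open Classical in
theorem card_admissible_edges [Fintype V] {F : Finset (V × V)} (h : IsRootedForest_s1 F) :
    #{e : V × V | e ∉ F ∧ IsRootedForest_s1 (insert e F)} =
      Fintype.card V * (Fintype.card V - #F - 1) := by
  have hfiber : ∀ v : V, #{r : V | (∀ w, (r, w) ∉ F) ∧
      ¬ Relation.ReflTransGen (fun x y => (x, y) ∈ F) v r} = Fintype.card V - #F - 1 := by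
    intro v
    obtain ⟨r, hr, huniq⟩ := h.existsUnique_root v
    have herase : ({r : V | (∀ w, (r, w) ∉ F) ∧
        ¬ Relation.ReflTransGen (fun x y => (x, y) ∈ F) v r} : Finset V) =
        ({r : V | ∀ w, (r, w) ∉ F} : Finset V).erase r := by
      ext s
      simp only [mem_filter, mem_univ, true_and, mem_erase]
      constructor
      · rintro ⟨hs, hvs⟩
        exact ⟨fun hsr => hvs (hsr ▸ hr.2), hs⟩
      · rintro ⟨hsr, hs⟩
        exact ⟨hs, fun hvs => hsr (huniq s ⟨hs, hvs⟩)⟩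
    rw [herase, card_erase_of_mem (by simpa using hr.1), ← h.card_roots_add_card,
      Nat.add_sub_cancel]
  rw [card_eq_sum_card_fiberwise (f := Prod.snd) (t := univ) (fun _ _ => mem_coe.2 (mem_univ _)),
    ← smul_eq_mul, ← card_univ, ← sum_const]
  refine sum_congr rfl fun v _ => (Eq.trans ?_ (hfiber v))
  refine card_bij (fun e _ => e.1) ?_ ?_ ?_
  · rintro ⟨r, w⟩ he
    simp only [mem_filter, mem_univ, true_and] at he ⊢
    obtain ⟨he, rfl⟩ := he
    exact h.insert_edge_iff.1 he
  · rintro ⟨r, w⟩ he ⟨s, w'⟩ he' hrs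
    simp only [mem_filter, mem_univ, true_and] at he he' hrs
    rw [hrs, he.2, he'.2]
  · intro r hr
    simp only [mem_filter, mem_univ, true_and] at hr
    exact ⟨(r, v), by simpa using h.insert_edge_iff.2 hr, rfl⟩

end IsRootedForest_s1

open Classical in
/-- Double counting of the pairs of rooted forests `F ⊆ F'` with `i` and `i + 1` edges. -/
theorem card_rootedForest_succ (V : Type) [Fintype V] (i : ℕ) :
    #{F : Finset (V × V) | IsRootedForest_s1 F ∧ #F = i + 1} * (i + 1) =
      #{F : Finset (V × V) | IsRootedForest_s1 F ∧ #F = i} *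
        (Fintype.card V * (Fintype.card V - i - 1)) := by
  refine (card_mul_eq_card_mul (fun F F' : Finset (V × V) => F ⊆ F') ?_ ?_).symm
  · intro F hF
    simp only [mem_filter, mem_univ, true_and] at hF
    obtain ⟨hF, rfl⟩ := hF
    rw [← hF.card_admissible_edges]
    refine (card_bij (fun e _ => insert e F) ?_ ?_ ?_).symm
    · intro e he
      simp only [mem_filter, mem_univ, true_and] at he
      simp [bipartiteAbove, he.1, he.2]
    · intro e he e' he' heq
      simp only [mem_filter, mem_univ, true_and] at he he'
      exact (insert_inj he.1).1 heq
    · intro F' hF'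
      simp only [bipartiteAbove, mem_filter, mem_univ, true_and] at hF'
      obtain ⟨⟨hF', hcard⟩, hsub⟩ := hF'
      obtain ⟨e, he⟩ := card_eq_one.1 (show #(F' \ F) = 1 by rw [card_sdiff_of_subset hsub]; omega)
      have heF : e ∉ F := (mem_sdiff.1 (he ▸ mem_singleton_self e)).2
      have hins : insert e F = F' := by
        rw [insert_eq, ← he, sdiff_union_of_subset hsub]
      exact ⟨e, by simp [heF, hins, hF'], hins⟩
  · intro F' hF'
    simp only [mem_filter, mem_univ, true_and] at hF'
    obtain ⟨hF', hcard⟩ := hF'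
    rw [← hcard]
    refine (card_bij (fun e _ => F'.erase e) ?_ ?_ ?_).symm
    · intro e he
      simp [bipartiteBelow, hF'.mono (erase_subset e F'), card_erase_of_mem he, hcard,
        erase_subset]
    · intro e he e' he' heq
      exact F'.erase_injOn he he' heq
    · intro F hF
      simp only [bipartiteBelow, mem_filter, mem_univ, true_and] at hF
      obtain ⟨⟨-, hc⟩, hsub⟩ := hF
      obtain ⟨e, he⟩ := card_eq_one.1 (show #(F' \ F) = 1 by rw [card_sdiff_of_subset hsub]; omega)
      refine ⟨e, (mem_sdiff.1 (he ▸ mem_singleton_self e)).1, ?_⟩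
      rw [erase_eq, ← he, Finset.sdiff_sdiff_eq_self hsub]

open Classical in
theorem card_rootedForest (V : Type) [Fintype V] [Nonempty V] (i : ℕ) :
    #{F : Finset (V × V) | IsRootedForest_s1 F ∧ #F = i} =
      Fintype.card V ^ i * (Fintype.card V - 1).choose i := by
  induction i with
  | zero =>
    have hempty : IsRootedForest_s1 (∅ : Finset (V × V)) := by
      refine ⟨fun _ _ _ h => absurd h (notMem_empty _), fun a ha => ?_⟩
      obtain ⟨b, hb, -⟩ := Relation.TransGen.head'_iff.1 ha
      exact notMem_empty _ hb
    have : ({F : Finset (V × V) | IsRootedForest_s1 F ∧ #F = 0} : Finset _) = {∅} := by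
      ext F
      simp only [mem_filter, mem_univ, true_and, mem_singleton, card_eq_zero]
      exact ⟨And.right, fun hF => ⟨hF ▸ hempty, hF⟩⟩
    rw [this]
    simp
  | succ i ih =>
    have hrec := card_rootedForest_succ V i
    have hchoose := Nat.choose_succ_right_eq (Fintype.card V - 1) i
    refine Nat.eq_of_mul_eq_mul_right (Nat.succ_pos i) ?_
    rw [Nat.succ_eq_add_one, hrec, ih, mul_assoc _ (Nat.choose _ (i + 1)), hchoose,
      Nat.sub_right_comm]
    ring

end RootedForest

section MorseMatching

variable {V : Type} [DecidableEq V]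

/-- The arc `({u, v}, {u})` of the Hasse diagram in which the node `u` is matched with the edge
to `v`. -/
def edgeNodeArc : V × V ↪ Finset V × Finset V where
  toFun e := ({e.1, e.2}, {e.1})
  inj' := by
    rintro ⟨u, v⟩ ⟨u', v'⟩ h
    simp only [Prod.mk.injEq, singleton_inj] at h
    obtain ⟨h, rfl⟩ := h
    have hv : v ∈ ({u, v'} : Finset V) := h ▸ by simp
    have hv' : v' ∈ ({u, v} : Finset V) := h ▸ by simp
    simp only [mem_insert, mem_singleton] at hv hv'
    grind

theorem mem_map_edgeNodeArc {F : Finset (V × V)} {g f : Finset V} :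
    (g, f) ∈ F.map edgeNodeArc ↔ ∃ u v, (u, v) ∈ F ∧ g = {u, v} ∧ f = {u} := by
  rw [mem_map]
  constructor
  · rintro ⟨⟨u, v⟩, huv, h⟩
    exact ⟨u, v, huv, (congrArg Prod.fst h).symm, (congrArg Prod.snd h).symm⟩
  · rintro ⟨u, v, huv, rfl, rfl⟩
    exact ⟨(u, v), huv, rfl⟩

variable [Fintype V]

theorem hasseArc_graphComplex_top {g f : Finset V} :
    HasseArc (graphComplex (⊤ : SimpleGraph V)) g f ↔ ∃ u v, u ≠ v ∧ g = {u, v} ∧ f = {u} := by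
  simp only [HasseArc, graphComplex, mem_filter, mem_univ, true_and, SimpleGraph.top_adj]
  constructor
  · rintro ⟨hg, hf, hfg, hcard⟩
    rcases hg with ⟨a, rfl⟩ | ⟨a, b, hab, rfl⟩
    · rcases hf with ⟨c, rfl⟩ | ⟨c, d, hcd, rfl⟩
      · simp at hcard
      · simp [card_pair hcd] at hcard
    · rcases hf with ⟨c, rfl⟩ | ⟨c, d, hcd, rfl⟩
      · have hc := hfg.1 (mem_singleton_self c)
        simp only [mem_insert, mem_singleton] at hc
        rcases hc with rfl | rfl
        · exact ⟨c, b, hab, rfl, rfl⟩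
        · exact ⟨c, a, hab.symm, pair_comm _ _, rfl⟩
      · simp [card_pair hcd, card_pair hab] at hcard
  · rintro ⟨u, v, huv, rfl, rfl⟩
    refine ⟨Or.inr ⟨u, v, huv, rfl⟩, Or.inl ⟨u, rfl⟩, ?_, by simp [card_pair huv]⟩
    rw [ssubset_iff_of_subset (by simp)]
    exact ⟨v, by simp, by simpa using huv.symm⟩

theorem IsRootedForest_s1.exists_of_morseStep_singleton {F : Finset (V × V)} {a : V} {y : Finset V}
    (h : MorseStep (graphComplex (⊤ : SimpleGraph V)) ↑(F.map edgeNodeArc) {a} y) :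
    ∃ b, (a, b) ∈ F ∧ y = {a, b} := by
  rcases h with ⟨h, -⟩ | ⟨h, -⟩
  · obtain ⟨u, v, huv, h, -⟩ := hasseArc_graphComplex_top.1 h
    have := congrArg card h
    simp [card_pair huv] at this
  · obtain ⟨u, v, huv, rfl, hu⟩ := mem_map_edgeNodeArc.1 (mem_coe.1 h)
    obtain rfl := singleton_inj.1 hu
    exact ⟨v, huv, rfl⟩

theorem IsRootedForest_s1.eq_singleton_of_morseStep_pair {F : Finset (V × V)} (hF : IsRootedForest_s1 F)
    {a b : V} {y : Finset V} (hab : (a, b) ∈ F)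
    (h : MorseStep (graphComplex (⊤ : SimpleGraph V)) ↑(F.map edgeNodeArc) {a, b} y) :
    y = {b} := by
  rcases h with ⟨h, hM⟩ | ⟨h, -⟩
  · obtain ⟨u, v, -, huv, rfl⟩ := hasseArc_graphComplex_top.1 h
    have hu : u ∈ ({a, b} : Finset V) := huv ▸ by simp
    simp only [mem_insert, mem_singleton] at hu
    rcases hu with rfl | rfl
    · exact absurd (mem_coe.2 (mem_map_edgeNodeArc.2 ⟨u, b, hab, rfl, rfl⟩)) hM
    · rfl
  · obtain ⟨u, v, -, -, h⟩ := mem_map_edgeNodeArc.1 (mem_coe.1 h)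
    have := congrArg card h
    simp [card_pair (hF.ne hab)] at this

theorem IsRootedForest_s1.not_transGen_morseStep {F : Finset (V × V)} (hF : IsRootedForest_s1 F)
    (s : Finset V) : ¬ Relation.TransGen
      (MorseStep (graphComplex (⊤ : SimpleGraph V)) ↑(F.map edgeNodeArc)) s s := by
  have hnode : ∀ a : V, ¬ Relation.TransGen
      (MorseStep (graphComplex (⊤ : SimpleGraph V)) ↑(F.map edgeNodeArc)) {a} {a} := by
    intro a ha
    have key : ∀ y, Relation.TransGen
        (MorseStep (graphComplex (⊤ : SimpleGraph V)) ↑(F.map edgeNodeArc)) {a} y →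
        (∃ b, y = {b} ∧ Relation.TransGen (fun x y => (x, y) ∈ F) a b) ∨
        (∃ b c, y = {b, c} ∧ (b, c) ∈ F ∧
          Relation.ReflTransGen (fun x y => (x, y) ∈ F) a b) := by
      intro y hy
      induction hy with
      | single hy =>
        obtain ⟨b, hb, rfl⟩ := exists_of_morseStep_singleton hy
        exact Or.inr ⟨a, b, rfl, hb, .refl⟩
      | tail _ hyz ih =>
        rcases ih with ⟨b, rfl, hb⟩ | ⟨b, c, rfl, hbc, hb⟩
        · obtain ⟨c, hc, rfl⟩ := exists_of_morseStep_singleton hyz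
          exact Or.inr ⟨b, c, rfl, hc, hb.to_reflTransGen⟩
        · exact Or.inl ⟨c, hF.eq_singleton_of_morseStep_pair hbc hyz, .tail' hb hbc⟩
    rcases key _ ha with ⟨b, hab, hb⟩ | ⟨b, c, h, hbc, -⟩
    · obtain rfl := singleton_inj.1 hab
      exact hF.acyclic a hb
    · have := congrArg card h
      simp [card_pair (hF.ne hbc)] at this
  intro hs
  obtain ⟨t, hst, hts⟩ := Relation.TransGen.head'_iff.1 hs
  rcases hst with ⟨h, hM⟩ | ⟨h, hH⟩
  · obtain ⟨u, v, -, -, rfl⟩ := hasseArc_graphComplex_top.1 h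
    exact hnode u (.tail' hts (Or.inl ⟨h, hM⟩))
  · obtain ⟨u, v, -, -, rfl⟩ := hasseArc_graphComplex_top.1 hH
    exact hnode u hs

theorem isMorseMatching_map_edgeNodeArc {F : Finset (V × V)} :
    IsMorseMatching (graphComplex (⊤ : SimpleGraph V)) ↑(F.map edgeNodeArc) ↔
      IsRootedForest_s1 F := by
  constructor
  · rintro ⟨hH, hM, hA⟩
    have hmem : ∀ {a b}, (a, b) ∈ F →
        (({a, b}, {a}) : Finset V × Finset V) ∈ (F.map edgeNodeArc : Set _) :=
      fun h => mem_coe.2 (mem_map_edgeNodeArc.2 ⟨_, _, h, rfl, rfl⟩)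
    have hne : ∀ {a b}, (a, b) ∈ F → a ≠ b := by
      rintro a b hab rfl
      obtain ⟨-, -, -, h⟩ := hH _ (hmem hab)
      simp at h
    refine ⟨fun a b c hb hc => ?_, fun a ha => hA {a} ?_⟩
    · by_contra hbc
      refine (hM _ (hmem hb) _ (hmem hc) fun h => hbc ?_).2.2.2 rfl
      exact (Prod.mk.inj (edgeNodeArc.injective (a₁ := (a, b)) (a₂ := (a, c)) h)).2
    · have hstep : ∀ x y, (x, y) ∈ F → Relation.TransGen
          (MorseStep (graphComplex (⊤ : SimpleGraph V)) ↑(F.map edgeNodeArc)) {x} {y} := by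
        intro x y hxy
        refine .head (Or.inr ⟨hmem hxy, hH _ (hmem hxy)⟩) (.single (Or.inl ⟨?_, fun h => ?_⟩))
        · exact hasseArc_graphComplex_top.2 ⟨y, x, (hne hxy).symm, pair_comm _ _, rfl⟩
        · refine (hM _ (hmem hxy) _ h fun heq => hne hxy ?_).1 rfl
          exact singleton_inj.1 (Prod.mk.inj heq).2
      exact Relation.TransGen.trans_induction_on
        (motive := fun {x y} _ => Relation.TransGen
          (MorseStep (graphComplex (⊤ : SimpleGraph V)) ↑(F.map edgeNodeArc)) {x} {y})
        ha (fun h => hstep _ _ h) fun _ _ h h' => h.trans h'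
  · intro hF
    refine ⟨?_, ?_, hF.not_transGen_morseStep⟩
    · rintro ⟨g, f⟩ hp
      obtain ⟨u, v, huv, rfl, rfl⟩ := mem_map_edgeNodeArc.1 (mem_coe.1 hp)
      exact hasseArc_graphComplex_top.2 ⟨u, v, hF.ne huv, rfl, rfl⟩
    · rintro ⟨g, f⟩ hp ⟨g', f'⟩ hq hne
      obtain ⟨u, v, huv, rfl, rfl⟩ := mem_map_edgeNodeArc.1 (mem_coe.1 hp)
      obtain ⟨u', v', huv', rfl, rfl⟩ := mem_map_edgeNodeArc.1 (mem_coe.1 hq)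
      have hu : u ≠ u' := by
        rintro rfl
        exact hne (by rw [hF.functional huv huv'])
      refine ⟨fun h => ?_, fun h => ?_, fun h => ?_, fun h => hu (singleton_inj.1 h)⟩
      · replace h : ({u, v} : Finset V) = {u', v'} := h
        have hmem : u ∈ ({u', v'} : Finset V) := h ▸ by simp
        have hmem' : u' ∈ ({u, v} : Finset V) := h ▸ by simp
        simp only [mem_insert, mem_singleton] at hmem hmem'
        obtain rfl := hmem.resolve_left hu
        obtain rfl := hmem'.resolve_left hu.symm
        exact hF.swap_notMem huv huv'
      · have := congrArg card h
        simp [card_pair (hF.ne huv)] at this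
      · have := congrArg card h
        simp [card_pair (hF.ne huv')] at this

theorem exists_map_edgeNodeArc_eq {M : Finset (Finset V × Finset V)}
    (hM : ∀ p ∈ M, HasseArc (graphComplex (⊤ : SimpleGraph V)) p.1 p.2) :
    ∃ F : Finset (V × V), F.map edgeNodeArc = M := by
  have hsub : (M : Set (Finset V × Finset V)) ⊆ edgeNodeArc '' (Set.univ : Set (V × V)) := by
    rintro ⟨g, f⟩ hp
    obtain ⟨u, v, -, rfl, rfl⟩ := hasseArc_graphComplex_top.1 (hM _ hp)
    exact ⟨(u, v), trivial, rfl⟩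
  obtain ⟨F, -, hF⟩ := subset_set_image_iff.1 hsub
  exact ⟨F, by rw [map_eq_image, hF]⟩

variable (V) in
open Classical in
theorem ncard_morseMatching_eq_card_rootedForest (i : ℕ) :
    {M : Finset (Finset V × Finset V) |
        IsMorseMatching (graphComplex (⊤ : SimpleGraph V)) ↑M ∧ #M = i}.ncard =
      #{F : Finset (V × V) | IsRootedForest_s1 F ∧ #F = i} := by
  rw [← Set.ncard_coe_finset]
  refine Eq.trans ?_ (Set.ncard_image_of_injective _ (map_injective edgeNodeArc))
  congr 1
  ext M
  simp only [Set.mem_ofPred_eq, Set.mem_image, coe_filter, mem_univ, true_and]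
  constructor
  · rintro ⟨hM, hcard⟩
    obtain ⟨F, rfl⟩ := exists_map_edgeNodeArc_eq hM.1
    exact ⟨F, ⟨isMorseMatching_map_edgeNodeArc.1 hM, by simpa using hcard⟩, rfl⟩
  · rintro ⟨F, ⟨hF, hcard⟩, rfl⟩
    exact ⟨isMorseMatching_map_edgeNodeArc.2 hF, by simpa using hcard⟩

end MorseMatching

/-- the number of Morse matchings of cardinality `i` on the complete graph
`K_n` equals `C(n,i) * (n-i) * n^(i-1)`, for `1 ≤ i ≤ n`. -/
theorem card_morse_matchings_complete_graph (n i : ℕ) (h1 : 1 ≤ i) (h2 : i ≤ n) :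
    {M : Finset (Finset (Fin n) × Finset (Fin n)) |
        IsMorseMatching (graphComplex (⊤ : SimpleGraph (Fin n))) ↑M ∧ M.card = i}.ncard
      = n.choose i * (n - i) * n ^ (i - 1) := by
  obtain ⟨m, rfl⟩ := Nat.exists_eq_add_of_le' (h1.trans h2)
  obtain ⟨j, rfl⟩ := Nat.exists_eq_add_of_le' h1
  have hcount := (ncard_morseMatching_eq_card_rootedForest (Fin (m + 1)) (j + 1)).trans
    (card_rootedForest (Fin (m + 1)) (j + 1))
  rw [← Nat.choose_mul_succ_eq]
  simp only [Fintype.card_fin, Nat.add_sub_cancel] at hcount ⊢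
  exact hcount.trans (by ring)
end

section
/- Let A and B be subcomplexes of a finite simplicial complex with A ∩ B nonempty, and suppose both inclusion maps |A ∩ B| ↪ |A| and |A ∩ B| ↪ |B| are homotopic to constant maps. Then |A ∪ B| is homotopy equivalent to the wedge |A| ∨ susp(|A ∩ B|) ∨ |B|, where susp denotes the unreduced suspension. -/
open Finset

/-- A finite abstract simplicial complex: a collection of nonempty finite sets closed
under taking nonempty subsets. -/
def IsComplex {V : Type} (K : Finset (Finset V)) : Prop :=
  ∀ s ∈ K, s.Nonempty ∧ ∀ t, t ⊆ s → t.Nonempty → t ∈ K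

/-- Geometric realization of the finite abstract simplicial complex `K`, as a subspace of
`V → ℝ`: the convex combinations of vertices whose support is a face of `K`. -/
def realization {V : Type} [Fintype V] (K : Finset (Finset V)) : Set (V → ℝ) :=
  {x | (∀ v, 0 ≤ x v) ∧ (∑ v, x v) = 1 ∧ ∃ s ∈ K, ∀ v, x v ≠ 0 ↔ v ∈ s}

lemma realization_mono {V : Type} [Fintype V] {K L : Finset (Finset V)} (h : K ⊆ L) :
    realization K ⊆ realization L := by
  rintro x ⟨h0, h1, s, hs, hsupp⟩
  exact ⟨h0, h1, s, h hs, hsupp⟩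

/-- The inclusion map between geometric realizations induced by an inclusion of complexes. -/
def inclMap {V : Type} [Fintype V] {K L : Finset (Finset V)} (h : K ⊆ L) :
    C(↥(realization K), ↥(realization L)) :=
  ⟨Set.inclusion (realization_mono h), continuous_inclusion (realization_mono h)⟩

/-- The unreduced suspension of a topological space `X`: the quotient of `X × [0,1]`
collapsing `X × {0}` to a point and `X × {1}` to a point. -/
def Susp (X : Type) [TopologicalSpace X] : Type :=
  Quot fun p q : X × unitInterval => p.2 = q.2 ∧ (p.2 = 0 ∨ p.2 = 1)

instance (X : Type) [TopologicalSpace X] : TopologicalSpace (Susp X) :=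
  inferInstanceAs (TopologicalSpace (Quot _))

/-- The wedge (one-point union) of three pointed spaces: the disjoint union with the three
base points identified. -/
def Wedge3 (X Y Z : Type) [TopologicalSpace X] [TopologicalSpace Y] [TopologicalSpace Z]
    (x₀ : X) (y₀ : Y) (z₀ : Z) : Type :=
  Quot fun u v : X ⊕ Y ⊕ Z =>
    (u = Sum.inl x₀ ∧ v = Sum.inr (Sum.inl y₀)) ∨
    (u = Sum.inl x₀ ∧ v = Sum.inr (Sum.inr z₀))

instance (X Y Z : Type) [TopologicalSpace X] [TopologicalSpace Y] [TopologicalSpace Z]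
    (x₀ : X) (y₀ : Y) (z₀ : Z) : TopologicalSpace (Wedge3 X Y Z x₀ y₀ z₀) :=
  inferInstanceAs (TopologicalSpace (Quot _))

section HomotopyPushout

open unitInterval

variable {P Q X Y Z A B C M : Type} [TopologicalSpace P] [TopologicalSpace Q]
  [TopologicalSpace X] [TopologicalSpace Y] [TopologicalSpace Z] [TopologicalSpace A]
  [TopologicalSpace B] [TopologicalSpace C] [TopologicalSpace M]

/-- The square `p ∘ i = y ∘ f` exhibits `Z` as the pushout of `i` and `f` in topological
spaces. -/
structure IsTopPushout (i : C(Q, P)) (f : C(Q, Y)) (p : C(P, Z)) (y : C(Y, Z)) : Prop where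
  comm : ∀ q, p (i q) = y (f q)
  surj : ∀ z, (∃ a, p a = z) ∨ ∃ b, y b = z
  desc : ∀ (W : Type) [TopologicalSpace W] (g : C(P, W)) (h : C(Y, W)),
    (∀ q, g (i q) = h (f q)) → ∃ k : C(Z, W), (∀ a, k (p a) = g a) ∧ ∀ b, k (y b) = h b

/-- The homotopy extension property of a continuous map. -/
def HasHEP (i : C(Q, P)) : Prop :=
  ∀ (W : Type) [TopologicalSpace W] (g : C(P, W)) (h : C(Q × I, W)),
    (∀ q, h (q, 0) = g (i q)) →
      ∃ k : C(P × I, W), (∀ a, k (a, 0) = g a) ∧ ∀ q t, k (i q, t) = h (q, t)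

lemma exists_isTopPushout (i : C(Q, P)) (f : C(Q, Y)) :
    ∃ (Z : Type) (_ : TopologicalSpace Z) (p : C(P, Z)) (y : C(Y, Z)),
      IsTopPushout i f p y := by
  let r : P ⊕ Y → P ⊕ Y → Prop := fun u v => ∃ q, u = Sum.inl (i q) ∧ v = Sum.inr (f q)
  refine ⟨Quot r, inferInstance, ⟨fun a => Quot.mk r (Sum.inl a),
    continuous_quot_mk.comp continuous_inl⟩, ⟨fun b => Quot.mk r (Sum.inr b),
    continuous_quot_mk.comp continuous_inr⟩, fun q => Quot.sound ⟨q, rfl, rfl⟩, ?_, ?_⟩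
  · rintro ⟨a | b⟩
    · exact Or.inl ⟨a, rfl⟩
    · exact Or.inr ⟨b, rfl⟩
  · intro W _ g h hgh
    refine ⟨⟨Quot.lift (Sum.elim g h) ?_, continuous_quot_lift _ (by fun_prop)⟩,
      fun _ => rfl, fun _ => rfl⟩
    rintro _ _ ⟨q, rfl, rfl⟩
    exact hgh q

/-- Compatible homotopies on the two pieces of a pushout glue to a homotopy. -/
lemma IsTopPushout.homotopic {i : C(Q, P)} {f : C(Q, Y)} {p : C(P, Z)} {y : C(Y, Z)}
    (hZ : IsTopPushout i f p y) {k k' : C(Z, X)} (g : C(P × I, X)) (h : C(Y × I, X))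
    (hgh : ∀ q t, g (i q, t) = h (f q, t))
    (hg0 : ∀ a, g (a, 0) = k (p a)) (hg1 : ∀ a, g (a, 1) = k' (p a))
    (hh0 : ∀ b, h (b, 0) = k (y b)) (hh1 : ∀ b, h (b, 1) = k' (y b)) :
    k.Homotopic k' := by
  obtain ⟨l, hlp, hly⟩ := hZ.desc C(I, X) g.curry h.curry
    (fun q => ContinuousMap.ext fun t => hgh q t)
  have hp : ∀ a t, l (p a) t = g (a, t) := fun a t => by rw [hlp]; rfl
  have hy : ∀ b t, l (y b) t = h (b, t) := fun b t => by rw [hly]; rfl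
  refine ⟨⟨l.uncurry.comp ContinuousMap.prodSwap, fun z => ?_, fun z => ?_⟩⟩
  · obtain ⟨a, rfl⟩ | ⟨b, rfl⟩ := hZ.surj z
    · exact (hp a 0).trans (hg0 a)
    · exact (hy b 0).trans (hh0 b)
  · obtain ⟨a, rfl⟩ | ⟨b, rfl⟩ := hZ.surj z
    · exact (hp a 1).trans (hg1 a)
    · exact (hy b 1).trans (hh1 b)

/-- Attaching `P` along the initial end of a homotopy is homotopy equivalent to attaching the
cylinder `P × I` along the whole homotopy. -/
lemma HasHEP.homotopyEquiv_cylinder {i : C(Q, P)} (hi : HasHEP i) {F : C(Q × I, Y)}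
    {f : C(Q, Y)} (hf : ∀ q, F (q, 0) = f q) {p : C(P, X)} {y : C(Y, X)}
    (hX : IsTopPushout i f p y) {p' : C(P × I, Z)} {y' : C(Y, Z)}
    (hZ : IsTopPushout (i.prodMap (ContinuousMap.id I)) F p' y') :
    Nonempty (ContinuousMap.HomotopyEquiv X Z) := by
  have hc : ∀ q t, p' (i q, t) = y' (F (q, t)) := fun q t => hZ.comm (q, t)
  obtain ⟨N, _, n, m, hN⟩ :=
    exists_isTopPushout i (⟨fun q => (q, 0), by fun_prop⟩ : C(Q, Q × I))
  have hnm : ∀ q, n (i q) = m (q, 0) := hN.comm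
  obtain ⟨r, hr0, hrq⟩ := hi N n m (fun q => (hnm q).symm)
  obtain ⟨s, hsn, hsm⟩ := hN.desc (P × I) ⟨fun a => (a, 0), by fun_prop⟩
    (i.prodMap (ContinuousMap.id I)) (fun q => rfl)
  have hsm' : ∀ q t, s (m (q, t)) = (i q, t) := fun q t => hsm (q, t)
  obtain ⟨d, hdn, hdm⟩ := hN.desc X p (y.comp F)
    (fun q => (hX.comm q).trans (congrArg y (hf q).symm))
  obtain ⟨k, hkp, hky⟩ := hZ.desc X (d.comp r) y (by
    rintro ⟨q, t⟩
    change d (r (i q, t)) = _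
    rw [hrq, hdm]
    rfl)
  obtain ⟨j, hjp, hjy⟩ := hX.desc Z (p'.comp ⟨fun a => (a, 0), by fun_prop⟩) y' (by
    intro q
    change p' (i q, 0) = _
    rw [hc, hf])
  have hjd : ∀ u, j (d u) = p' (s u) := by
    intro u
    obtain ⟨a, rfl⟩ | ⟨⟨q, t⟩, rfl⟩ := hN.surj u
    · rw [hdn, hsn, hjp]; rfl
    · rw [hdm, hsm', hc]; exact hjy _
  refine ⟨⟨j, k, ?_, ?_⟩⟩
  · have : k.comp j = ContinuousMap.id X := by
      ext u
      obtain ⟨a, rfl⟩ | ⟨b, rfl⟩ := hX.surj u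
      · change k (j (p a)) = p a
        rw [hjp]
        change k (p' (a, 0)) = p a
        rw [hkp]
        change d (r (a, 0)) = p a
        rw [hr0, hdn]
      · change k (j (y b)) = y b
        rw [hjy, hky]
    rw [this]
  · refine ContinuousMap.Homotopic.symm (hZ.homotopic
      ⟨fun w => p' ((s (r (w.1.1, w.2 * w.1.2))).1,
        Set.Icc.convexComb w.1.2 (s (r w.1)).2 w.2), ?_⟩
      (y'.comp ContinuousMap.fst) ?_ ?_ ?_ (fun _ => rfl) ?_)
    · have := Set.Icc.continuous_convexComb_prod (a := (0 : ℝ)) (b := 1)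
      have h2 : Continuous fun w : (P × I) × I =>
          Set.Icc.convexComb w.1.2 (s (r w.1)).2 w.2 :=
        this.comp (f := fun w : (P × I) × I => (w.1.2, (s (r w.1)).2, w.2)) (by fun_prop)
      fun_prop
    · rintro ⟨q, t⟩ u
      change p' ((s (r (i q, u * t))).1, Set.Icc.convexComb t (s (r (i q, t))).2 u) = _
      rw [hrq, hrq, hsm', hsm', Set.Icc.convexComb_eq, hc]
      rfl
    · rintro ⟨a, t⟩
      change p' ((s (r (a, 0 * t))).1, Set.Icc.convexComb t (s (r (a, t))).2 0) = p' (a, t)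
      rw [zero_mul, hr0, hsn, Set.Icc.convexComb_zero]
      rfl
    · rintro ⟨a, t⟩
      change p' ((s (r (a, 1 * t))).1, Set.Icc.convexComb t (s (r (a, t))).2 1) =
        j (k (p' (a, t)))
      rw [one_mul, Set.Icc.convexComb_one, hkp]
      exact (hjd _).symm
    · intro b
      change y' b = j (k (y' b))
      rw [hky, hjy]

/-- Attaching a space along homotopic maps defined on a cofibration yields homotopy equivalent
spaces. -/
lemma HasHEP.homotopyEquiv_of_homotopic {i : C(Q, P)} (hi : HasHEP i) {f g : C(Q, Y)}
    (hfg : f.Homotopic g) {p : C(P, X)} {y : C(Y, X)} (hX : IsTopPushout i f p y)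
    {p' : C(P, Z)} {y' : C(Y, Z)} (hZ : IsTopPushout i g p' y') :
    Nonempty (ContinuousMap.HomotopyEquiv X Z) := by
  obtain ⟨F⟩ := hfg
  let G : C(Q × I, Y) := F.toContinuousMap.comp ContinuousMap.prodSwap
  obtain ⟨N, _, n, m, hN⟩ := exists_isTopPushout (i.prodMap (ContinuousMap.id I)) G
  let rev : ∀ S : Type, [TopologicalSpace S] → C(S × I, S × I) := fun S _ =>
    ⟨fun w => (w.1, unitInterval.symm w.2), by fun_prop⟩
  have hrev : ∀ (S : Type) [TopologicalSpace S] (w : S × I), rev S (rev S w) = w := by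
    intro S _ w
    simp [rev]
  have hN' : IsTopPushout (i.prodMap (ContinuousMap.id I)) (G.comp (rev Q))
      (n.comp (rev P)) m := by
    refine ⟨fun w => hN.comm (rev Q w), fun z => ?_, fun W _ a b hab => ?_⟩
    · obtain ⟨a, rfl⟩ | h := hN.surj z
      · exact Or.inl ⟨rev P a, congrArg n (hrev P a)⟩
      · exact Or.inr h
    · obtain ⟨k, hkn, hkm⟩ := hN.desc W (a.comp (rev P)) b (fun w => by
        have := hab (rev Q w)
        change _ = b (G (rev Q (rev Q w))) at this
        rw [hrev] at this
        exact this)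
      refine ⟨k, fun w => ?_, hkm⟩
      change k (n (rev P w)) = _
      rw [hkn]
      exact congrArg a (hrev P w)
  obtain ⟨e₁⟩ := hi.homotopyEquiv_cylinder (fun q => F.apply_zero q) hX hN
  obtain ⟨e₂⟩ := hi.homotopyEquiv_cylinder (f := g) (fun q => by
    change F (unitInterval.symm 0, q) = g q
    rw [unitInterval.symm_zero]
    exact F.apply_one q) hZ hN'
  exact ⟨e₁.trans e₂.symm⟩

/-- The inclusion of the two ends of the cylinder `C × I`. -/
def cylinderEnds (C : Type) [TopologicalSpace C] : C(C ⊕ C, C × I) :=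
  ⟨Sum.elim (fun c => (c, 0)) (fun c => (c, 1)), by fun_prop⟩

lemma hasHEP_cylinderEnds : HasHEP (cylinderEnds C) := by
  intro W _ g h hgh
  have h0 : ∀ c, h (Sum.inl c, 0) = g (c, 0) := fun c => hgh (Sum.inl c)
  have h1 : ∀ c, h (Sum.inr c, 0) = g (c, 1) := fun c => hgh (Sum.inr c)
  let pr : ℝ → I := Set.projIcc 0 1 zero_le_one
  have hpr : Continuous pr := continuous_projIcc
  have hd : ∀ w : (C × I) × I, (1 - 2 * (w.2 : ℝ) / 3) ≠ 0 := fun w => by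
    have := w.2.2.2
    linarith
  let k : (C × I) × I → W := fun w =>
    if 3 * (w.1.2 : ℝ) ≤ w.2 then h (Sum.inl w.1.1, pr (w.2 - 3 * w.1.2))
    else if 3 * (1 - (w.1.2 : ℝ)) ≤ w.2 then h (Sum.inr w.1.1, pr (w.2 - 3 * (1 - w.1.2)))
    else g (w.1.1, pr ((w.1.2 - w.2 / 3) / (1 - 2 * w.2 / 3)))
  have hk : Continuous k := by
    refine Continuous.if_le (by fun_prop) (Continuous.if_le (by fun_prop) ?_ ?_ ?_ ?_)
      (by fun_prop) (by fun_prop) ?_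
    · exact g.continuous.comp (Continuous.prodMk (by fun_prop)
        (hpr.comp (Continuous.div (by fun_prop) (by fun_prop) hd)))
    · fun_prop
    · fun_prop
    · intro w hw
      have e1 : (w.2 : ℝ) - 3 * (1 - w.1.2) = 0 := by linarith
      have e2 : ((w.1.2 : ℝ) - w.2 / 3) / (1 - 2 * w.2 / 3) = 1 := by
        rw [div_eq_one_iff_eq (hd w)]
        linarith
      rw [e1, e2]
      simpa [pr, Set.projIcc_left, Set.projIcc_right] using h1 w.1.1
    · intro w hw
      have hw1 := w.2.2.2
      have e1 : (w.2 : ℝ) - 3 * w.1.2 = 0 := by linarith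
      have e2 : ((w.1.2 : ℝ) - w.2 / 3) / (1 - 2 * w.2 / 3) = 0 := by
        rw [div_eq_zero_iff]
        left
        linarith
      rw [if_neg (by linarith), e1, e2]
      simpa [pr, Set.projIcc_left, Set.projIcc_right] using h0 w.1.1
  refine ⟨⟨k, hk⟩, ?_, ?_⟩
  · rintro ⟨c, s⟩
    change k ((c, s), 0) = _
    have hs := s.2
    simp only [k]
    split_ifs with ha hb
    · have : s = 0 := Subtype.ext (le_antisymm (by
        have : 3 * (s : ℝ) ≤ 0 := ha
        change (s : ℝ) ≤ 0
        linarith) hs.1)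
      subst this
      simpa [pr] using h0 c
    · have : s = 1 := Subtype.ext (le_antisymm hs.2 (by
        have : 3 * (1 - (s : ℝ)) ≤ 0 := hb
        change 1 ≤ (s : ℝ)
        linarith))
      subst this
      simpa [pr] using h1 c
    · simp [pr]
  · rintro (c | c) t
    · change k ((c, 0), t) = _
      have ht := t.2.1
      simp only [k]
      rw [if_pos (by simpa using ht)]
      simp [pr]
    · change k ((c, 1), t) = _
      have ht := t.2
      simp only [k]
      rw [if_neg (by have := ht.2; simp; linarith), if_pos (by simpa using ht.1)]
      simp [pr]

/-- Homotopies between maps add up to a homotopy between their disjoint unions. -/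
lemma homotopic_sumMap {f f' : C(C, A)} {g g' : C(C, B)} (hf : f.Homotopic f')
    (hg : g.Homotopic g') :
    ContinuousMap.Homotopic (⟨Sum.map f g, by fun_prop⟩ : C(C ⊕ C, A ⊕ B))
      ⟨Sum.map f' g', by fun_prop⟩ := by
  obtain ⟨F⟩ := hf
  obtain ⟨G⟩ := hg
  let F' : C(C × I, A ⊕ B) := ⟨fun w => Sum.inl (F (w.2, w.1)), by fun_prop⟩
  let G' : C(C × I, A ⊕ B) := ⟨fun w => Sum.inr (G (w.2, w.1)), by fun_prop⟩
  let L : C(C ⊕ C, C(I, A ⊕ B)) := ⟨Sum.elim F'.curry G'.curry, by fun_prop⟩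
  refine ⟨⟨L.uncurry.comp ContinuousMap.prodSwap, ?_, ?_⟩⟩
  · rintro (c | c)
    · exact congrArg Sum.inl (F.apply_zero c)
    · exact congrArg Sum.inr (G.apply_zero c)
  · rintro (c | c)
    · exact congrArg Sum.inl (F.apply_one c)
    · exact congrArg Sum.inr (G.apply_one c)

/-- The pushout along a cofibration is homotopy equivalent to the double mapping cylinder. -/
lemma HasHEP.homotopyEquiv_doubleMappingCylinder {f : C(C, A)} (hf : HasHEP f) {g : C(C, B)}
    {a : C(A, X)} {b : C(B, X)} (hX : IsTopPushout f g a b) {m : C(C × I, M)}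
    {n : C(A ⊕ B, M)}
    (hM : IsTopPushout (cylinderEnds C) ⟨Sum.map f g, by fun_prop⟩ m n) :
    Nonempty (ContinuousMap.HomotopyEquiv X M) := by
  have hm0 : ∀ c, m (c, 0) = n (Sum.inl (f c)) := fun c => hM.comm (Sum.inl c)
  have hm1 : ∀ c, m (c, 1) = n (Sum.inr (g c)) := fun c => hM.comm (Sum.inr c)
  let nA : C(A, M) := n.comp ⟨Sum.inl, continuous_inl⟩
  let nB : C(B, M) := n.comp ⟨Sum.inr, continuous_inr⟩
  obtain ⟨k, hk0, hkf⟩ := hf M nA m hm0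
  obtain ⟨φ, hφa, hφb⟩ := hX.desc M (k.comp ⟨fun x => (x, 1), by fun_prop⟩) nB
    (fun c => (hkf c 1).trans (hm1 c))
  have hφa' : ∀ x, φ (a x) = k (x, 1) := hφa
  obtain ⟨ψ, hψm, hψn⟩ := hM.desc X (a.comp (f.comp ContinuousMap.fst))
    ⟨Sum.elim a b, by fun_prop⟩ (by
      rintro (c | c)
      · rfl
      · exact hX.comm c)
  have hψA : ∀ x, ψ (nA x) = a x := fun x => hψn (Sum.inl x)
  have hψB : ∀ x, ψ (nB x) = b x := fun x => hψn (Sum.inr x)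
  refine ⟨⟨φ, ψ, ?_, ?_⟩⟩
  · refine ContinuousMap.Homotopic.symm (hX.homotopic (ψ.comp k) (b.comp ContinuousMap.fst)
      ?_ ?_ ?_ (fun _ => rfl) ?_)
    · intro c t
      change ψ (k (f c, t)) = b (g c)
      rw [hkf, hψm]
      exact hX.comm c
    · intro x
      change ψ (k (x, 0)) = a x
      rw [hk0, hψA]
    · intro x
      change ψ (k (x, 1)) = ψ (φ (a x))
      rw [hφa']
    · intro x
      change b x = ψ (φ (b x))
      rw [hφb, hψB]
  · let L : C(A ⊕ B, C(I, M)) :=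
      ⟨Sum.elim k.curry (nB.comp (ContinuousMap.fst : C(B × I, B))).curry, by fun_prop⟩
    refine ContinuousMap.Homotopic.symm (hM.homotopic
      (m.comp ⟨fun w => (w.1.1, w.1.2 ⊔ w.2), by fun_prop⟩) L.uncurry ?_ ?_ ?_ ?_ ?_)
    · rintro (c | c) t
      · change m (c, 0 ⊔ t) = k (f c, t)
        rw [hkf, sup_eq_right.2 unitInterval.nonneg']
      · change m (c, 1 ⊔ t) = nB (g c)
        rw [sup_eq_left.2 unitInterval.le_one', hm1]
        rfl
    · rintro ⟨c, s⟩
      change m (c, s ⊔ 0) = m (c, s)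
      rw [sup_eq_left.2 unitInterval.nonneg']
    · rintro ⟨c, s⟩
      change m (c, s ⊔ 1) = φ (ψ (m (c, s)))
      rw [sup_eq_right.2 unitInterval.le_one', hψm]
      change _ = φ (a (f c))
      rw [hφa', hkf]
    · rintro (x | x)
      · exact hk0 x
      · rfl
    · rintro (x | x)
      · change k (x, 1) = φ (ψ (nA x))
        rw [hψA, hφa']
      · change nB x = φ (ψ (nB x))
        rw [hψB, hφb]

/-- The projection of the cylinder onto the suspension. -/
def suspMk (C : Type) [TopologicalSpace C] : C(C × I, Susp C) :=
  ⟨Quot.mk _, continuous_quot_mk⟩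

lemma suspMk_zero (c c' : C) : suspMk C (c, 0) = suspMk C (c', 0) :=
  Quot.sound ⟨rfl, Or.inl rfl⟩

lemma suspMk_one (c c' : C) : suspMk C (c, 1) = suspMk C (c', 1) :=
  Quot.sound ⟨rfl, Or.inr rfl⟩

lemma exists_susp_desc (h : C(C × I, X)) (h0 : ∀ c c', h (c, 0) = h (c', 0))
    (h1 : ∀ c c', h (c, 1) = h (c', 1)) : ∃ k : C(Susp C, X), ∀ w, k (suspMk C w) = h w := by
  refine ⟨⟨Quot.lift h ?_, continuous_quot_lift _ h.continuous⟩, fun _ => rfl⟩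
  rintro ⟨c, s⟩ ⟨d, t⟩ ⟨rfl : s = t, hs : s = 0 ∨ s = 1⟩
  rcases hs with rfl | rfl
  · exact h0 c d
  · exact h1 c d

/-- The wedge lemma for a pushout of null-homotopic maps, one of which is a cofibration. -/
theorem IsTopPushout.homotopyEquiv_wedge3 {f : C(C, A)} (hf : HasHEP f) {g : C(C, B)}
    {x : C(A, X)} {y : C(B, X)} (hX : IsTopPushout f g x y) (c₀ : C)
    (hfc : f.Homotopic (ContinuousMap.const C (f c₀)))
    (hgc : g.Homotopic (ContinuousMap.const C (g c₀)))
    [Unique Q] (hQ : HasHEP (ContinuousMap.const Q (g c₀))) :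
    Nonempty (ContinuousMap.HomotopyEquiv X
      (Wedge3 A (Susp C) B (f c₀) (suspMk C (c₀, 0)) (g c₀))) := by
  set a := f c₀
  set b := g c₀
  -- the double mapping cylinder of `f` and `g`
  obtain ⟨M, _, m, n, hM⟩ := exists_isTopPushout (cylinderEnds C)
    (⟨Sum.map f g, by fun_prop⟩ : C(C ⊕ C, A ⊕ B))
  -- `A` with the suspension attached at its south pole
  obtain ⟨Y, _, yS, yA, hY⟩ := exists_isTopPushout
    (ContinuousMap.const Q (suspMk C (c₀, 0))) (ContinuousMap.const Q a)
  have hyS : yS (suspMk C (c₀, 0)) = yA a := hY.comm default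
  -- `B` attached to the north pole
  obtain ⟨N, _, nB, nY, hN⟩ := exists_isTopPushout (ContinuousMap.const Q b)
    (ContinuousMap.const Q (yS (suspMk C (c₀, 1))))
  have hnB : nB b = nY (yS (suspMk C (c₀, 1))) := hN.comm default
  have hN' : IsTopPushout (cylinderEnds C)
      ⟨Sum.map (ContinuousMap.const C a) (ContinuousMap.const C b), by fun_prop⟩
      (nY.comp (yS.comp (suspMk C))) ⟨Sum.elim (nY.comp yA) nB, by fun_prop⟩ := by
    refine ⟨?_, fun z => ?_, fun W _ u v huv => ?_⟩
    · rintro (c | c)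
      · change nY (yS (suspMk C (c, 0))) = nY (yA a)
        rw [suspMk_zero c c₀, hyS]
      · change nY (yS (suspMk C (c, 1))) = nB b
        rw [suspMk_one c c₀, hnB]
    · obtain ⟨z, rfl⟩ | ⟨z, rfl⟩ := hN.surj z
      · exact Or.inr ⟨Sum.inr z, rfl⟩
      · obtain ⟨⟨z⟩, rfl⟩ | ⟨z, rfl⟩ := hY.surj z
        · exact Or.inl ⟨z, rfl⟩
        · exact Or.inr ⟨Sum.inl z, rfl⟩
    · have hu0 : ∀ c, u (c, 0) = v (Sum.inl a) := fun c => huv (Sum.inl c)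
      have hu1 : ∀ c, u (c, 1) = v (Sum.inr b) := fun c => huv (Sum.inr c)
      obtain ⟨k, hk⟩ := exists_susp_desc u (fun c c' => (hu0 c).trans (hu0 c').symm)
        (fun c c' => (hu1 c).trans (hu1 c').symm)
      obtain ⟨l, hlS, hlA⟩ := hY.desc W k (v.comp ⟨Sum.inl, continuous_inl⟩)
        (fun _ => (hk _).trans (hu0 c₀))
      obtain ⟨o, hoB, hoY⟩ := hN.desc W (v.comp ⟨Sum.inr, continuous_inr⟩) l
        (fun _ => ((hlS _).trans ((hk _).trans (hu1 c₀))).symm)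
      refine ⟨o, fun w => (hoY _).trans ((hlS _).trans (hk w)), ?_⟩
      rintro (w | w)
      · exact (hoY _).trans (hlA w)
      · exact hoB w
  let T := Wedge3 A (Susp C) B a (suspMk C (c₀, 0)) b
  let q : C(A ⊕ Susp C ⊕ B, T) := ⟨Quot.mk _, continuous_quot_mk⟩
  have hqS : q (Sum.inl a) = q (Sum.inr (Sum.inl (suspMk C (c₀, 0)))) :=
    Quot.sound (Or.inl ⟨rfl, rfl⟩)
  have hqB : q (Sum.inl a) = q (Sum.inr (Sum.inr b)) := Quot.sound (Or.inr ⟨rfl, rfl⟩)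
  obtain ⟨j, hjS, hjA⟩ := hY.desc T (q.comp ⟨fun w => Sum.inr (Sum.inl w), by fun_prop⟩)
    (q.comp ⟨Sum.inl, continuous_inl⟩) (fun _ => hqS.symm)
  have hT : IsTopPushout (ContinuousMap.const Q b)
      (ContinuousMap.const Q (yS (suspMk C (c₀, 0))))
      (q.comp ⟨fun w => Sum.inr (Sum.inr w), by fun_prop⟩) j := by
    refine ⟨fun _ => (hqB.symm.trans hqS).trans (hjS _).symm, ?_, fun W _ u v huv => ?_⟩
    · rintro ⟨w | w | w⟩
      · exact Or.inr ⟨yA w, hjA w⟩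
      · exact Or.inr ⟨yS w, hjS w⟩
      · exact Or.inl ⟨w, rfl⟩
    · have huv' : u b = v (yS (suspMk C (c₀, 0))) := huv default
      let e : A ⊕ Susp C ⊕ B → W := Sum.elim (v.comp yA) (Sum.elim (v.comp yS) u)
      have he : Continuous e := by fun_prop
      let k : C(T, W) := ⟨Quot.lift e (by
        rintro _ _ (⟨rfl, rfl⟩ | ⟨rfl, rfl⟩)
        · exact congrArg v hyS.symm
        · exact ((congrArg v hyS.symm).trans huv'.symm)), continuous_quot_lift _ he⟩
      refine ⟨k, fun _ => rfl, fun w => ?_⟩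
      obtain ⟨w, rfl⟩ | ⟨w, rfl⟩ := hY.surj w
      · exact congrArg k (hjS w)
      · exact congrArg k (hjA w)
  have hpoles : (ContinuousMap.const Q (yS (suspMk C (c₀, 1)))).Homotopic
      (ContinuousMap.const Q (yS (suspMk C (c₀, 0)))) :=
    ContinuousMap.Homotopic.symm
      ⟨⟨⟨fun w => yS (suspMk C (c₀, w.1)), by fun_prop⟩, fun _ => rfl, fun _ => rfl⟩⟩
  obtain ⟨e₁⟩ := hf.homotopyEquiv_doubleMappingCylinder hX hM
  obtain ⟨e₂⟩ := hasHEP_cylinderEnds.homotopyEquiv_of_homotopic (homotopic_sumMap hfc hgc) hM hN'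
  obtain ⟨e₃⟩ := hQ.homotopyEquiv_of_homotopic hpoles hN hT
  exact ⟨(e₁.trans e₂).trans e₃⟩

end HomotopyPushout

/-- Continuous maps on two closed sets covering the space glue when they agree on the overlap. -/
lemma exists_glue_isClosed {X W : Type} [TopologicalSpace X] [TopologicalSpace W] {S T : Set X}
    (hS : IsClosed S) (hT : IsClosed T) (hST : ∀ x, x ∈ S ∨ x ∈ T) (f : C(S, W)) (g : C(T, W))
    (hfg : ∀ x (hs : x ∈ S) (ht : x ∈ T), f ⟨x, hs⟩ = g ⟨x, ht⟩) :
    ∃ k : C(X, W), (∀ x : S, k x = f x) ∧ ∀ x : T, k x = g x := by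
  classical
  let k : X → W := fun x => if h : x ∈ S then f ⟨x, h⟩ else g ⟨x, (hST x).resolve_left h⟩
  have hkf : ∀ x : S, k x = f x := fun x => dif_pos x.2
  have hkg : ∀ x : T, k x = g x := by
    intro x
    by_cases h : (x : X) ∈ S
    · exact (hkf ⟨x, h⟩).trans (hfg x h x.2)
    · exact dif_neg h
  have hSU : ContinuousOn k S := continuousOn_iff_continuous_domRestrict.2
    (f.continuous.congr fun x => (hkf x).symm)
  have hTU : ContinuousOn k T := continuousOn_iff_continuous_domRestrict.2
    (g.continuous.congr fun x => (hkg x).symm)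
  have hU : S ∪ T = Set.univ := Set.eq_univ_of_forall hST
  refine ⟨⟨k, ?_⟩, hkf, hkg⟩
  rw [← continuousOn_univ, ← hU]
  exact hSU.union_of_isClosed hTU hS hT

lemma IsComplex.inter {V : Type} [DecidableEq V] {A B : Finset (Finset V)}
    (hA : IsComplex A) (hB : IsComplex B) :
    IsComplex (A ∩ B) := fun s hs =>
  ⟨(hA s (Finset.mem_inter.1 hs).1).1, fun t hts ht => Finset.mem_inter.2
    ⟨(hA s (Finset.mem_inter.1 hs).1).2 t hts ht, (hB s (Finset.mem_inter.1 hs).2).2 t hts ht⟩⟩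

lemma isComplex_vertex {V : Type} (v : V) : IsComplex {({v} : Finset V)} := by
  intro s hs
  rw [Finset.mem_singleton] at hs
  subst hs
  refine ⟨Finset.singleton_nonempty v, fun t ht hne => ?_⟩
  exact Finset.mem_singleton.2 (hne.subset_singleton_iff.1 ht)

section Realization

open unitInterval

variable {V : Type} [Fintype V]

/-- Lower all coordinates of `x` by `θ`, discard the negative ones, and renormalize. -/
noncomputable def truncate (x : V → ℝ) (θ : ℝ) : V → ℝ :=
  fun v => max (x v - θ) 0 / ∑ w, max (x w - θ) 0

/-- The largest amount by which `truncate` lowers coordinates in `hasHEP_inclMap`. -/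
noncomputable def truncateBound (V : Type) [Fintype V] : ℝ := (2 * (Fintype.card V + 1 : ℝ))⁻¹

lemma truncateBound_pos : 0 < truncateBound V := by
  unfold truncateBound
  positivity

lemma sum_truncate_pos {x : V → ℝ} (h1 : ∑ v, x v = 1) {θ : ℝ} (hθ : θ ≤ truncateBound V) :
    0 < ∑ v, max (x v - θ) 0 := by
  have hle : ∑ v, (x v - θ) ≤ ∑ v, max (x v - θ) 0 :=
    Finset.sum_le_sum fun v _ => le_max_left _ _
  have hc : (Fintype.card V : ℝ) * truncateBound V < 1 := by
    rw [truncateBound, ← div_eq_mul_inv, div_lt_one (by positivity)]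
    have : (0 : ℝ) ≤ Fintype.card V := by positivity
    linarith
  have hm : (Fintype.card V : ℝ) * θ ≤ Fintype.card V * truncateBound V := by gcongr
  rw [Finset.sum_sub_distrib, h1, Finset.sum_const, card_univ, nsmul_eq_mul] at hle
  linarith

lemma truncate_mem_realization {L : Finset (Finset V)} {x : V → ℝ} {θ : ℝ}
    (hpos : 0 < ∑ v, max (x v - θ) 0)
    (hL : ∀ s : Finset V, s.Nonempty → (∀ v ∈ s, θ < x v) → s ∈ L) :
    truncate x θ ∈ realization L := by
  refine ⟨fun v => by unfold truncate; positivity, ?_, univ.filter fun v => θ < x v,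
    hL _ ?_ (by simp), fun v => ?_⟩
  · simp only [truncate]
    rw [← Finset.sum_div, div_self hpos.ne']
  · obtain ⟨v, -, hv⟩ := Finset.exists_ne_zero_of_sum_ne_zero hpos.ne'
    refine ⟨v, by simpa using hv⟩
  · simp [truncate, hpos.ne']

lemma truncate_zero {K : Finset (Finset V)} {x : V → ℝ} (hx : x ∈ realization K) :
    truncate x 0 = x := by
  funext v
  simp [truncate, hx.1, hx.2.1]

lemma continuous_truncate {S : Type} [TopologicalSpace S] {x : S → V → ℝ} {θ : S → ℝ}
    (hx : Continuous x) (hθ : Continuous θ) (hpos : ∀ s, 0 < ∑ v, max (x s v - θ s) 0) :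
    Continuous fun s => truncate (x s) (θ s) := by
  refine continuous_pi fun v => ?_
  exact Continuous.div (by fun_prop) (by fun_prop) fun s => (hpos s).ne'

lemma truncate_mem_self {K : Finset (Finset V)} (hK : IsComplex K) {x : V → ℝ}
    (hx : x ∈ realization K) {θ : ℝ} (h0 : 0 ≤ θ) (hθ : θ ≤ truncateBound V) :
    truncate x θ ∈ realization K := by
  refine truncate_mem_realization (sum_truncate_pos hx.2.1 hθ) fun s hs hsx => ?_
  obtain ⟨-, -, t, ht, hsupp⟩ := hx
  exact (hK t ht).2 s (fun v hv => (hsupp v).1 (h0.trans_lt (hsx v hv)).ne') hs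

variable [DecidableEq V]

/-- The largest threshold at which some superlevel set of `x` contains a nonface of `L`. -/
noncomputable def nonfaceLevel (L : Finset (Finset V)) (x : V → ℝ) : ℝ :=
  univ.sup' univ_nonempty fun s : Finset V =>
    if h : s.Nonempty ∧ s ∉ L then s.inf' h.1 x else 0

lemma continuous_nonfaceLevel (L : Finset (Finset V)) : Continuous (nonfaceLevel L) := by
  refine Continuous.finset_sup'_apply univ_nonempty fun s _ => ?_
  by_cases h : s.Nonempty ∧ s ∉ L
  · simp only [dif_pos h]
    exact Continuous.finset_inf'_apply h.1 fun v _ => continuous_apply v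
  · simp only [dif_neg h]
    exact continuous_const

lemma nonfaceLevel_nonneg (L : Finset (Finset V)) (x : V → ℝ) : 0 ≤ nonfaceLevel L x := by
  refine le_trans ?_ (Finset.le_sup' _ (mem_univ (∅ : Finset V)))
  simp

lemma mem_of_nonfaceLevel_lt {L : Finset (Finset V)} {x : V → ℝ} {s : Finset V}
    (hs : s.Nonempty) (h : ∀ v ∈ s, nonfaceLevel L x < x v) : s ∈ L := by
  by_contra hL
  have h1 : s.inf' hs x ≤ nonfaceLevel L x := by
    refine le_trans ?_ (Finset.le_sup' _ (mem_univ s))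
    rw [dif_pos ⟨hs, hL⟩]
  obtain ⟨v, hv, he⟩ := s.exists_mem_eq_inf' hs x
  exact absurd (h v hv) (not_lt.2 (he ▸ h1))

lemma nonfaceLevel_eq_zero {L : Finset (Finset V)} (hL : IsComplex L) {x : V → ℝ}
    (hx : x ∈ realization L) : nonfaceLevel L x = 0 := by
  obtain ⟨h0, h1, s, hs, hsupp⟩ := hx
  refine le_antisymm (Finset.sup'_le _ _ fun t _ => ?_) (nonfaceLevel_nonneg L x)
  split_ifs with h
  · obtain ⟨v, hvt, hvs⟩ := Finset.not_subset.1 fun hts => h.2 ((hL s hs).2 t hts h.1)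
    have hv : x v = 0 := by
      by_contra hv
      exact hvs ((hsupp v).1 hv)
    exact hv ▸ Finset.inf'_le x hvt
  · exact le_rfl

lemma mem_realization_of_nonfaceLevel {K L : Finset (Finset V)} {x : V → ℝ}
    (hx : x ∈ realization K) (h : nonfaceLevel L x ≤ 0) : x ∈ realization L := by
  obtain ⟨h0, h1, s, hs, hsupp⟩ := hx
  refine ⟨h0, h1, s, mem_of_nonfaceLevel_lt (x := x) ?_ fun v hv =>
    h.trans_lt ((h0 v).lt_of_ne' ((hsupp v).2 hv)), hsupp⟩
  obtain ⟨v, -, hv⟩ := Finset.exists_ne_zero_of_sum_ne_zero (h1.trans_ne one_ne_zero)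
  exact ⟨v, (hsupp v).1 hv⟩

lemma truncate_nonfaceLevel_mem {K L : Finset (Finset V)} {x : V → ℝ} (hx : x ∈ realization K)
    (hθ : nonfaceLevel L x ≤ truncateBound V) :
    truncate x (nonfaceLevel L x) ∈ realization L :=
  truncate_mem_realization (sum_truncate_pos hx.2.1 hθ) fun _ hs hsx =>
    mem_of_nonfaceLevel_lt hs hsx

/-- The inclusion of a subcomplex has the homotopy extension property. -/
theorem hasHEP_inclMap {K L : Finset (Finset V)} (hK : IsComplex K) (hL : IsComplex L)
    (h : L ⊆ K) : HasHEP (inclMap h) := by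
  intro W _ g l hgl
  let c := truncateBound V
  have hc : 0 < c := truncateBound_pos
  have hτ : Continuous fun w : realization K × I => nonfaceLevel L w.1 :=
    (continuous_nonfaceLevel L).comp (by fun_prop)
  have hct : Continuous fun w : realization K × I => c * (w.2 : ℝ) := by fun_prop
  have hc0 : ∀ t : I, 0 ≤ c * (t : ℝ) := fun t => mul_nonneg hc.le t.2.1
  have hc1 : ∀ t : I, c * (t : ℝ) ≤ c := fun t => mul_le_of_le_one_right hc.le t.2.2
  let S : Set (realization K × I) := {w | c * (w.2 : ℝ) ≤ nonfaceLevel L w.1}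
  let T : Set (realization K × I) := {w | nonfaceLevel L w.1 ≤ c * (w.2 : ℝ)}
  let u : C(S, realization K) := ⟨fun w => ⟨truncate w.1.1 (c * w.1.2),
      truncate_mem_self hK w.1.1.2 (hc0 _) (hc1 _)⟩,
    Continuous.subtype_mk (continuous_truncate (by fun_prop) (by fun_prop)
      fun w => sum_truncate_pos w.1.1.2.2.1 (hc1 _)) _⟩
  let r : C(T, realization L) := ⟨fun w => ⟨truncate w.1.1 (nonfaceLevel L w.1.1),
      truncate_nonfaceLevel_mem w.1.1.2 (w.2.trans (hc1 _))⟩,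
    Continuous.subtype_mk (continuous_truncate (by fun_prop)
      (hτ.comp continuous_subtype_val)
      fun w => sum_truncate_pos w.1.1.2.2.1 (w.2.trans (hc1 _))) _⟩
  let pr : C(T, I) := ⟨fun w => Set.projIcc 0 1 zero_le_one
      ((w.1.2 : ℝ) - nonfaceLevel L w.1.1 / c),
    continuous_projIcc.comp (Continuous.sub (by fun_prop)
      ((hτ.comp continuous_subtype_val).div_const c))⟩
  obtain ⟨k, hkS, hkT⟩ := exists_glue_isClosed (isClosed_le hct hτ) (isClosed_le hτ hct)
    (fun w => le_total (c * (w.2 : ℝ)) (nonfaceLevel L w.1)) (g.comp u) (l.comp (r.prodMk pr)) (by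
      intro w hs ht
      have he : c * (w.2 : ℝ) = nonfaceLevel L w.1 := le_antisymm hs ht
      have hp : pr ⟨w, ht⟩ = 0 := by
        have : (w.2 : ℝ) - nonfaceLevel L w.1 / c = 0 := by
          rw [← he, mul_div_cancel_left₀ _ hc.ne', sub_self]
        change Set.projIcc 0 1 zero_le_one ((w.2 : ℝ) - nonfaceLevel L w.1 / c) = 0
        rw [this, Set.projIcc_left]
        rfl
      change g (u ⟨w, hs⟩) = l (r ⟨w, ht⟩, pr ⟨w, ht⟩)
      rw [hp, hgl]
      refine congrArg g (Subtype.ext ?_)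
      change truncate w.1.1 (c * w.2) = truncate w.1.1 (nonfaceLevel L w.1)
      rw [he])
  refine ⟨k, fun x => ?_, fun x t => ?_⟩
  · have hx : (x, (0 : I)) ∈ S := by
      change c * ((0 : I) : ℝ) ≤ _
      simpa using nonfaceLevel_nonneg L x
    refine (hkS ⟨_, hx⟩).trans (congrArg g (Subtype.ext ?_))
    change truncate x.1 (c * ((0 : I) : ℝ)) = x
    rw [Set.Icc.coe_zero, mul_zero, truncate_zero x.2]
  · have h0 : nonfaceLevel L (inclMap h x).1 = 0 := nonfaceLevel_eq_zero hL x.2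
    have hx : (inclMap h x, t) ∈ T := h0.trans_le (hc0 t)
    refine (hkT ⟨_, hx⟩).trans (congrArg l (Prod.ext (Subtype.ext ?_) ?_))
    · change truncate (inclMap h x).1 (nonfaceLevel L (inclMap h x).1) = x
      rw [h0]
      exact truncate_zero x.2
    · change Set.projIcc 0 1 zero_le_one ((t : ℝ) - nonfaceLevel L (inclMap h x).1 / c) = t
      rw [h0, zero_div, sub_zero, Set.projIcc_val]

/-- The realization of a union of complexes is the pushout of the realizations. -/
theorem isTopPushout_realization {A B : Finset (Finset V)} (hA : IsComplex A)
    (hB : IsComplex B) :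
    IsTopPushout (inclMap (Finset.inter_subset_left : A ∩ B ⊆ A))
      (inclMap (Finset.inter_subset_right : A ∩ B ⊆ B))
      (inclMap (Finset.subset_union_left : A ⊆ A ∪ B))
      (inclMap (Finset.subset_union_right : B ⊆ A ∪ B)) := by
  have hcov : ∀ x : realization (A ∪ B), (x : V → ℝ) ∈ realization A ∨
      (x : V → ℝ) ∈ realization B := by
    rintro ⟨x, h0, h1, s, hs, hsupp⟩
    exact (Finset.mem_union.1 hs).imp (fun h => ⟨h0, h1, s, h, hsupp⟩)
      fun h => ⟨h0, h1, s, h, hsupp⟩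
  have hclosed : ∀ L : Finset (Finset V), IsComplex L →
      IsClosed {x : realization (A ∪ B) | (x : V → ℝ) ∈ realization L} := by
    intro L hL
    have : {x : realization (A ∪ B) | (x : V → ℝ) ∈ realization L} =
        {x : realization (A ∪ B) | nonfaceLevel L (x : V → ℝ) ≤ 0} :=
      Set.ext fun x => ⟨fun hx => (nonfaceLevel_eq_zero hL hx).le,
        fun hx => mem_realization_of_nonfaceLevel x.2 hx⟩
    rw [this]
    exact isClosed_le ((continuous_nonfaceLevel L).comp continuous_subtype_val)
      continuous_const
  refine ⟨fun _ => rfl, fun x => ?_, fun W _ g h hgh => ?_⟩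
  · exact (hcov x).imp (fun hx => ⟨⟨x, hx⟩, rfl⟩) fun hx => ⟨⟨x, hx⟩, rfl⟩
  · obtain ⟨k, hkA, hkB⟩ := exists_glue_isClosed (hclosed A hA) (hclosed B hB) hcov
      (g.comp ⟨fun x => ⟨x.1.1, x.2⟩, by fun_prop⟩)
      (h.comp ⟨fun x => ⟨x.1.1, x.2⟩, by fun_prop⟩) (by
        intro x hxA hxB
        have hx : (x : V → ℝ) ∈ realization (A ∩ B) := by
          obtain ⟨h0, h1, s, hs, hsupp⟩ := hxA
          obtain ⟨-, -, t, ht, htsupp⟩ := hxB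
          have hst : s = t := Finset.ext fun v => (hsupp v).symm.trans (htsupp v)
          exact ⟨h0, h1, s, Finset.mem_inter.2 ⟨hs, hst ▸ ht⟩, hsupp⟩
        exact hgh ⟨x, hx⟩)
    exact ⟨k, fun a => hkA ⟨inclMap Finset.subset_union_left a, a.2⟩,
      fun b => hkB ⟨inclMap Finset.subset_union_right b, b.2⟩⟩

/-- The realization of a single vertex is a point. -/
lemma nonempty_unique_realization_vertex (v : V) :
    Nonempty (Unique (realization {({v} : Finset V)})) := by
  refine ⟨⟨⟨⟨Pi.single v 1, fun w => ?_, by simp, {v},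
    by simp, fun w => by simp [Pi.single_apply]⟩⟩, ?_⟩⟩
  · by_cases hw : w = v <;> simp [hw]
  rintro ⟨x, h0, h1, s, hs, hsupp⟩
  rw [Finset.mem_singleton] at hs
  subst hs
  have hz : ∀ w, w ≠ v → x w = 0 := fun w hw => by
    by_contra h
    exact hw (Finset.mem_singleton.1 ((hsupp w).1 h))
  have hv : x v = 1 := by
    rw [← h1]
    exact (Finset.sum_eq_single v (fun w _ hw => hz w hw) (by simp)).symm
  refine Subtype.ext (funext fun w => ?_)
  by_cases hw : w = v
  · subst hw
    simpa using hv
  · simpa [hw] using hz w hw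

end Realization

/-- A map homotopic to a constant is homotopic to the constant at each of its values. -/
lemma homotopic_const_apply {X Y : Type} [TopologicalSpace X] [TopologicalSpace Y] {f : C(X, Y)}
    {y : Y} (h : f.Homotopic (ContinuousMap.const X y)) (x : X) :
    f.Homotopic (ContinuousMap.const X (f x)) :=
  h.trans (h.comp (ContinuousMap.Homotopic.refl (ContinuousMap.const X x))).symm

/-- wedge lemma: if `A`, `B` are subcomplexes of a finite simplicial complex
with `A ∩ B` nonempty and both inclusions `|A ∩ B| ↪ |A|` and `|A ∩ B| ↪ |B|` are homotopic
to constant maps, then `|A ∪ B| ≃ |A| ∨ susp(|A ∩ B|) ∨ |B|`. -/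
theorem realization_union_homotopyEquiv_wedge
    {V : Type} [Fintype V] [DecidableEq V]
    (K A B : Finset (Finset V)) (hK : IsComplex K) (hA : IsComplex A) (hB : IsComplex B)
    (hAK : A ⊆ K) (hBK : B ⊆ K) (hne : (A ∩ B).Nonempty)
    (hconstA : ∃ a : ↥(realization A),
      (inclMap (Finset.inter_subset_left : A ∩ B ⊆ A)).Homotopic (ContinuousMap.const _ a))
    (hconstB : ∃ b : ↥(realization B),
      (inclMap (Finset.inter_subset_right : A ∩ B ⊆ B)).Homotopic (ContinuousMap.const _ b)) :
    ∃ (a : ↥(realization A)) (s : Susp ↥(realization (A ∩ B))) (b : ↥(realization B)),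
      Nonempty (ContinuousMap.HomotopyEquiv (↥(realization (A ∪ B)))
        (Wedge3 (↥(realization A)) (Susp ↥(realization (A ∩ B))) (↥(realization B)) a s b)) := by
  obtain ⟨a, ha⟩ := hconstA
  obtain ⟨b, hb⟩ := hconstB
  have hC := hA.inter hB
  obtain ⟨s, hs⟩ := hne
  obtain ⟨v, hv⟩ := (hC s hs).1
  have hvC : {({v} : Finset V)} ⊆ A ∩ B := Finset.singleton_subset_iff.2
    ((hC s hs).2 {v} (Finset.singleton_subset_iff.2 hv) (Finset.singleton_nonempty v))
  obtain ⟨_⟩ := nonempty_unique_realization_vertex v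
  let c₀ : realization (A ∩ B) := inclMap hvC default
  have hQ : HasHEP (ContinuousMap.const (realization {({v} : Finset V)})
      (inclMap (Finset.inter_subset_right : A ∩ B ⊆ B) c₀)) := by
    have hconst : inclMap (hvC.trans Finset.inter_subset_right) =
        ContinuousMap.const (realization {({v} : Finset V)})
          (inclMap (Finset.inter_subset_right : A ∩ B ⊆ B) c₀) :=
      ContinuousMap.ext fun x => by rw [Subsingleton.elim x default]; rfl
    exact hconst ▸ hasHEP_inclMap hB (isComplex_vertex v) _
  exact ⟨_, _, _, (isTopPushout_realization hA hB).homotopyEquiv_wedge3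
    (hasHEP_inclMap hA hC _) c₀ (homotopic_const_apply ha c₀) (homotopic_const_apply hb c₀) hQ⟩
end
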